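/- Let b̌ : ℕ → ℍ be a coefficient sequence such that the power series b(q) = ∑_{n≥0} qⁿ b̌(n) converges for every q ∈ 𝔹. Then the following are equivalent: (i) there exists C₁ such that for all finitely supported sequences a, c : ℕ → ℍ, |∑_{n≥0} conj(b̌(n)) · ( ∑_{k=0}^{n} a(k)·c(n−k) )| ≤ C₁·(∑_k |a(k)|²)^{1/2}·(∑_k |c(k)|²)^{1/2} (i.e. the Hankel bilinear form T_b(f,g) = ⟨f⋆g, b⟩_{H²(𝔹)} is bounded); (ii) the measure dμ_b(q) = |∂_c b(q)|² (1 − |q|²) dVol_𝔹(q) is a Carleson measure for H²(𝔹), i.e. there exists C₂ such that for every f ∈ H²(𝔹), (1/4)∫_{𝕊} ∫_{x²+y²<1} |f(x+yI)|² |∂_c b(x+yI)|² (1 − x² − y²) dx dy dA_𝕊(I) ≤ C₂·‖f‖²_{H²(𝔹)}. -/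

import Mathlib

open scoped Quaternion ENNReal
open MeasureTheory

/-- The Cullen (slice) derivative of `b(q) = ∑ₙ qⁿ b̌(n)`, namely
`∂_c b(q) = ∑_{n≥1} n·q^{n−1} b̌(n)`. -/
noncomputable def cullenDeriv (b : ℕ → ℍ[ℝ]) (q : ℍ[ℝ]) : ℍ[ℝ] :=
  ∑' n : ℕ, ((n + 1 : ℕ) : ℝ) • (q ^ n * b (n + 1))

/-- The identification of `ℝ³` with the imaginary quaternions. -/
def iQ (v : EuclideanSpace ℝ (Fin 3)) : ℍ[ℝ] := ⟨0, v 0, v 1, v 2⟩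

namespace SliceHankel

open Real Set Filter Topology

/-- The sum of the complex power series with coefficients `c`. -/
noncomputable def powSum (c : ℕ → ℂ) (z : ℂ) : ℂ := ∑' n, c n * z ^ n

/-- The coefficients of the derivative of the power series with coefficients `c`. -/
def derivCoeff (c : ℕ → ℂ) (n : ℕ) : ℂ := (n + 1) * c (n + 1)

lemma integral_exp_int_mul_I (k : ℤ) :
    ∫ θ in Ioo (-π) π, Complex.exp (k * θ * Complex.I) = if k = 0 then (2 * π : ℂ) else 0 := by
  rw [← integral_Ioc_eq_integral_Ioo,
    ← intervalIntegral.integral_of_le (by linarith [pi_pos])]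
  split_ifs with hk
  · simp [hk]; ring
  · have hc : (k : ℂ) * Complex.I ≠ 0 := mul_ne_zero (by exact_mod_cast hk) Complex.I_ne_zero
    have h : ∀ θ : ℝ, (k : ℂ) * θ * Complex.I = (k * Complex.I) * θ := fun θ => by ring
    simp_rw [h]
    rw [integral_exp_mul_complex hc]
    have : Complex.exp (k * Complex.I * (π : ℝ)) = Complex.exp (k * Complex.I * (-π : ℝ)) := by
      rw [Complex.exp_eq_exp_iff_exists_int]
      exact ⟨k, by push_cast; ring⟩
    rw [this]; simp

lemma lintegral_circle_sq {d : ℕ → ℂ} (hd : Summable fun n => ‖d n‖) :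
    ∫⁻ θ in Ioo (-π) π, ‖powSum d (Complex.exp (θ * Complex.I))‖ₑ ^ 2
      = ENNReal.ofReal (2 * π) * ∑' n, ‖d n‖ₑ ^ 2 := by
  set μ : Measure ℝ := volume.restrict (Ioo (-π) π) with hμ
  set F : ℕ × ℕ → ℝ → ℂ := fun p θ =>
    d p.1 * (starRingEnd ℂ) (d p.2) * Complex.exp (((p.1 : ℤ) - (p.2 : ℤ) : ℤ) * θ * Complex.I)
    with hF
  have hnF : ∀ p θ, ‖F p θ‖ = ‖d p.1‖ * ‖d p.2‖ := by
    intro p θ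
    have : (((p.1 : ℤ) - (p.2 : ℤ) : ℤ) : ℂ) * θ * Complex.I
        = ((((p.1 : ℤ) - (p.2 : ℤ) : ℤ) : ℝ) * θ : ℝ) * Complex.I := by push_cast; ring
    simp only [hF, this, norm_mul, RCLike.norm_conj, Complex.norm_exp_ofReal_mul_I, mul_one]
  have hdd : Summable fun p : ℕ × ℕ => ‖d p.1‖ * ‖d p.2‖ :=
    hd.mul_of_nonneg hd (fun _ => norm_nonneg _) (fun _ => norm_nonneg _)
  have hint : ∀ p, Integrable (F p) μ := by
    intro p
    refine Integrable.of_bound (C := ‖d p.1‖ * ‖d p.2‖) ?_ ?_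
    · exact (by fun_prop : Continuous (F p)).aestronglyMeasurable
    · exact Eventually.of_forall fun θ => (hnF p θ).le
  have hsum : Summable fun p => ∫ θ, ‖F p θ‖ ∂μ := by
    simp_rw [hnF, integral_const]
    exact hdd.mul_left _
  have key := hasSum_integral_of_summable_integral_norm hint hsum
  have hexp : ∀ θ : ℝ, ∀ n : ℕ, ‖d n * Complex.exp (θ * Complex.I) ^ n‖ = ‖d n‖ := by
    intro θ n
    rw [norm_mul, norm_pow, Complex.norm_exp_ofReal_mul_I, one_pow, mul_one]
  have hsq : ∀ θ : ℝ, ∑' p, F p θ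
      = ((‖powSum d (Complex.exp (θ * Complex.I))‖ ^ 2 : ℝ) : ℂ) := by
    intro θ
    have h1 : Summable fun n => ‖d n * Complex.exp (θ * Complex.I) ^ n‖ := by
      simpa only [hexp] using hd
    have h2 : Summable fun n =>
        ‖(starRingEnd ℂ) (d n * Complex.exp (θ * Complex.I) ^ n)‖ := by
      simpa only [RCLike.norm_conj] using h1
    rw [Complex.ofReal_pow, ← Complex.mul_conj', powSum, Complex.conj_tsum,
      tsum_mul_tsum_of_summable_norm h1 h2]
    refine tsum_congr fun p => ?_
    simp only [hF, map_mul, map_natCast, ← Complex.exp_conj, Complex.conj_ofReal, Complex.conj_I,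
      ← Complex.exp_nat_mul]
    have : Complex.exp (((p.1 : ℤ) - (p.2 : ℤ) : ℤ) * θ * Complex.I)
        = Complex.exp (p.1 * (θ * Complex.I)) * Complex.exp (p.2 * (θ * -Complex.I)) := by
      rw [← Complex.exp_add]; congr 1; push_cast; ring
    rw [this]; ring
  simp_rw [hsq] at key
  rw [integral_complex_ofReal] at key
  have hcoef : ∀ p : ℕ × ℕ, ∫ θ, F p θ ∂μ = if p.1 = p.2 then (2 * π * ‖d p.1‖ ^ 2 : ℂ) else 0 := by
    intro p
    simp only [hF]
    rw [integral_const_mul, integral_exp_int_mul_I]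
    by_cases h : p.1 = p.2
    · rw [if_pos (by omega), if_pos h, ← h, Complex.mul_conj']; ring
    · rw [if_neg (by omega), if_neg h, mul_zero]
  simp_rw [hcoef] at key
  have hdiag : HasSum (fun n : ℕ => (2 * π * ‖d n‖ ^ 2 : ℂ))
      ((∫ θ, ‖powSum d (Complex.exp (θ * Complex.I))‖ ^ 2 ∂μ : ℝ) : ℂ) := by
    have hinj : Function.Injective (fun n : ℕ => (n, n)) := fun a b h => (Prod.mk.inj h).1
    rw [← hinj.hasSum_iff] at key
    · simpa [Function.comp_def] using key
    · rintro ⟨a, b⟩ hab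
      rw [if_neg]
      rintro (rfl : a = b)
      exact hab ⟨_, rfl⟩
  have hdiag' : HasSum (fun n : ℕ => 2 * π * ‖d n‖ ^ 2)
      (∫ θ, ‖powSum d (Complex.exp (θ * Complex.I))‖ ^ 2 ∂μ) := by
    exact_mod_cast hdiag
  have hcont : Continuous fun θ : ℝ => powSum d (Complex.exp (θ * Complex.I)) := by
    unfold powSum
    exact continuous_tsum (fun n => by fun_prop) hd (fun n θ => (hexp θ n).le)
  have hb : ∀ θ : ℝ, ‖powSum d (Complex.exp (θ * Complex.I))‖ ≤ ∑' n, ‖d n‖ := fun θ =>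
    tsum_of_norm_bounded hd.hasSum fun n => (hexp θ n).le
  have hI : Integrable (fun θ : ℝ => ‖powSum d (Complex.exp (θ * Complex.I))‖ ^ 2) μ := by
    refine Integrable.of_bound (C := (∑' n, ‖d n‖) ^ 2) ?_ ?_
    · exact (by fun_prop : Continuous _).aestronglyMeasurable
    · refine Eventually.of_forall fun θ => ?_
      rw [norm_pow, norm_norm]
      exact pow_le_pow_left₀ (norm_nonneg _) (hb θ) 2
  have e1 : ∀ z : ℂ, ‖z‖ₑ ^ 2 = ENNReal.ofReal (‖z‖ ^ 2) := fun z => by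
    rw [← ofReal_norm, ENNReal.ofReal_pow (norm_nonneg _)]
  simp_rw [e1]
  rw [← ofReal_integral_eq_lintegral_ofReal hI (Eventually.of_forall fun θ => by positivity),
    ← hdiag'.tsum_eq, ENNReal.ofReal_tsum_of_nonneg (fun n => by positivity) hdiag'.summable,
    ← ENNReal.tsum_mul_left]
  refine tsum_congr fun n => ?_
  rw [ENNReal.ofReal_mul (by positivity)]

/-- The power series with coefficients `c` converges absolutely on the disc of radius `R`. -/
def ConvOn (c : ℕ → ℂ) (R : ℝ) : Prop := ∀ r, 0 ≤ r → r < R → Summable fun n => r ^ n * ‖c n‖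

lemma ConvOn.norm_summable {c : ℕ → ℂ} {R : ℝ} (hc : ConvOn c R) {z : ℂ} (hz : ‖z‖ < R) :
    Summable fun n => ‖c n * z ^ n‖ := by
  simpa [mul_comm] using hc ‖z‖ (norm_nonneg _) hz

lemma ConvOn.hasSum {c : ℕ → ℂ} {R : ℝ} (hc : ConvOn c R) {z : ℂ} (hz : ‖z‖ < R) :
    HasSum (fun n => c n * z ^ n) (powSum c z) :=
  (hc.norm_summable hz).of_norm.hasSum

lemma ConvOn.mono {c : ℕ → ℂ} {R R' : ℝ} (hc : ConvOn c R) (h : R' ≤ R) : ConvOn c R' :=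
  fun r h0 hr => hc r h0 (hr.trans_le h)

lemma ConvOn.norm_term_le {c : ℕ → ℂ} {r : ℝ} {z : ℂ} (hz : z ∈ Metric.ball (0 : ℂ) r) (n : ℕ) :
    ‖c n * z ^ n‖ ≤ r ^ n * ‖c n‖ := by
  rw [mem_ball_zero_iff] at hz
  rw [norm_mul, norm_pow, mul_comm]
  gcongr

lemma ConvOn.differentiableOn {c : ℕ → ℂ} {R : ℝ} (hc : ConvOn c R) :
    DifferentiableOn ℂ (powSum c) (Metric.ball 0 R) := by
  intro z hz
  rw [mem_ball_zero_iff] at hz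
  obtain ⟨r, hzr, hrR⟩ := exists_between hz
  have hr : 0 ≤ r := (norm_nonneg z).trans hzr.le
  have := Complex.differentiableOn_tsum_of_summable_norm (U := Metric.ball (0 : ℂ) r)
    (F := fun n z => c n * z ^ n) (hc r hr hrR) (fun n => by fun_prop) Metric.isOpen_ball
    (fun n w hw => ConvOn.norm_term_le hw n)
  exact (this.differentiableAt (Metric.isOpen_ball.mem_nhds
    (mem_ball_zero_iff.2 hzr))).differentiableWithinAt

lemma ConvOn.continuousOn {c : ℕ → ℂ} {R : ℝ} (hc : ConvOn c R) :
    ContinuousOn (powSum c) (Metric.ball 0 R) := hc.differentiableOn.continuousOn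

lemma ConvOn.hasSum_deriv {c : ℕ → ℂ} {R : ℝ} (hc : ConvOn c R) {z : ℂ} (hz : ‖z‖ < R) :
    HasSum (fun n => derivCoeff c n * z ^ n) (deriv (powSum c) z) := by
  obtain ⟨r, hzr, hrR⟩ := exists_between hz
  have hr : 0 ≤ r := (norm_nonneg z).trans hzr.le
  have := Complex.hasSum_deriv_of_summable_norm (U := Metric.ball (0 : ℂ) r)
    (F := fun n z => c n * z ^ n) (hc r hr hrR) (fun n => by fun_prop) Metric.isOpen_ball
    (fun n w hw => ConvOn.norm_term_le hw n) (mem_ball_zero_iff.2 hzr)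
  rw [← hasSum_nat_add_iff' 1] at this
  have h1 : (fun n => deriv (fun z : ℂ => c (n + 1) * z ^ (n + 1)) z)
      = fun n => derivCoeff c n * z ^ n := by
    ext n
    simp [derivCoeff]
    ring
  have h2 : deriv (fun w => ∑' i, c i * w ^ i) z
      - ∑ i ∈ Finset.range 1, deriv (fun z : ℂ => c i * z ^ i) z = deriv (powSum c) z := by
    simp
    rfl
  rwa [h1, h2] at this

lemma ConvOn.derivCoeff {c : ℕ → ℂ} {R : ℝ} (hc : ConvOn c R) : ConvOn (derivCoeff c) R := by
  intro r h0 hr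
  have := (hc.hasSum_deriv (z := r) (by simpa [abs_of_nonneg h0] using hr)).summable.norm
  simpa [abs_of_nonneg h0, mul_comm] using this

lemma ConvOn.deriv_powSum {c : ℕ → ℂ} {R : ℝ} (hc : ConvOn c R) {z : ℂ} (hz : ‖z‖ < R) :
    deriv (powSum c) z = powSum (SliceHankel.derivCoeff c) z :=
  (hc.hasSum_deriv hz).tsum_eq.symm

/-- The open unit disc as a subset of `ℝ × ℝ`. -/
def unitDisc : Set (ℝ × ℝ) := {p : ℝ × ℝ | p.1 ^ 2 + p.2 ^ 2 < 1}

lemma isOpen_unitDisc : IsOpen unitDisc := isOpen_lt (by fun_prop) continuous_const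

/-- The identification of `ℝ × ℝ` with the complex plane. -/
noncomputable def toC (p : ℝ × ℝ) : ℂ := p.1 + p.2 * Complex.I

lemma continuous_toC : Continuous toC := by unfold toC; fun_prop

lemma norm_toC_sq (p : ℝ × ℝ) : ‖toC p‖ ^ 2 = p.1 ^ 2 + p.2 ^ 2 := by
  rw [← Complex.normSq_eq_norm_sq, toC, Complex.normSq_add_mul_I]

lemma norm_toC_lt {p : ℝ × ℝ} (hp : p ∈ unitDisc) : ‖toC p‖ < 1 := by
  have : ‖toC p‖ ^ 2 < 1 := by rw [norm_toC_sq]; exact hp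
  nlinarith [norm_nonneg (toC p)]

/-- The measure `(1 - |z|²) dx dy` on the unit disc. -/
noncomputable def discMeasure : Measure (ℝ × ℝ) :=
  (volume.restrict unitDisc).withDensity fun p => ENNReal.ofReal (1 - p.1 ^ 2 - p.2 ^ 2)

lemma lintegral_discMeasure (f : ℝ × ℝ → ℝ≥0∞) :
    ∫⁻ p, f p ∂discMeasure
      = ∫⁻ p in unitDisc, f p * ENNReal.ofReal (1 - p.1 ^ 2 - p.2 ^ 2) := by
  rw [discMeasure, lintegral_withDensity_eq_lintegral_mul_non_measurable _ (by fun_prop)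
    (by simp)]
  simp [mul_comm]

lemma ae_discMeasure_of_forall {P : ℝ × ℝ → Prop} (h : ∀ p ∈ unitDisc, P p) :
    ∀ᵐ p ∂discMeasure, P p := by
  have : discMeasure ≪ volume.restrict unitDisc := withDensity_absolutelyContinuous _ _
  exact this.ae_le ((ae_restrict_iff' isOpen_unitDisc.measurableSet).2 (Eventually.of_forall h))

lemma lintegral_discMeasure_mono {f g : ℝ × ℝ → ℝ≥0∞} (h : ∀ p ∈ unitDisc, f p ≤ g p) :
    ∫⁻ p, f p ∂discMeasure ≤ ∫⁻ p, g p ∂discMeasure :=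
  lintegral_mono_ae (ae_discMeasure_of_forall h)

lemma lintegral_discMeasure_congr {f g : ℝ × ℝ → ℝ≥0∞} (h : ∀ p ∈ unitDisc, f p = g p) :
    ∫⁻ p, f p ∂discMeasure = ∫⁻ p, g p ∂discMeasure :=
  lintegral_congr_ae (ae_discMeasure_of_forall h)

lemma aemeasurable_discMeasure {E : Type*} [TopologicalSpace E] [MeasurableSpace E] [BorelSpace E]
    {f : ℂ → E} (hf : ContinuousOn f (Metric.ball 0 1)) :
    AEMeasurable (fun p => f (toC p)) discMeasure := by
  have h : AEMeasurable (fun p => f (toC p)) (volume.restrict unitDisc) := by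
    refine ContinuousOn.aemeasurable ?_ isOpen_unitDisc.measurableSet
    exact hf.comp continuous_toC.continuousOn
      fun p hp => mem_ball_zero_iff.2 (norm_toC_lt hp)
  exact h.mono_ac (withDensity_absolutelyContinuous _ _)

lemma lintegral_discMeasure_polar {h : ℂ → ℝ≥0∞} (hh : ContinuousOn h (Metric.ball 0 1)) :
    ∫⁻ p, h (toC p) ∂discMeasure = ∫⁻ r in Ioo (0 : ℝ) 1, ENNReal.ofReal (r * (1 - r ^ 2)) *
      ∫⁻ θ in Ioo (-π) π, h (r * Complex.exp (θ * Complex.I)) := by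
  rw [lintegral_discMeasure, ← lintegral_indicator isOpen_unitDisc.measurableSet,
    ← lintegral_comp_polarCoord_symm]
  have htoC : ∀ p : ℝ × ℝ, toC (polarCoord.symm p) = p.1 * Complex.exp (p.2 * Complex.I) := by
    intro p
    simp [toC, Complex.exp_mul_I]; ring
  have hsq : ∀ p : ℝ × ℝ, (polarCoord.symm p).1 ^ 2 + (polarCoord.symm p).2 ^ 2 = p.1 ^ 2 := by
    intro p
    simp only [polarCoord_symm_apply]
    linear_combination p.1 ^ 2 * Real.cos_sq_add_sin_sq p.2
  set G : ℝ × ℝ → ℝ≥0∞ := fun p => ENNReal.ofReal (p.1 * (1 - p.1 ^ 2)) *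
    h (p.1 * Complex.exp (p.2 * Complex.I)) with hG
  have h1 : ∫⁻ p in polarCoord.target, ENNReal.ofReal p.1 •
        unitDisc.indicator (fun p => h (toC p) * ENNReal.ofReal (1 - p.1 ^ 2 - p.2 ^ 2))
          (polarCoord.symm p)
      = ∫⁻ p in Ioo (0 : ℝ) 1 ×ˢ Ioo (-π) π, G p := by
    rw [← lintegral_indicator polarCoord.open_target.measurableSet,
      ← lintegral_indicator (measurableSet_Ioo.prod measurableSet_Ioo)]
    refine lintegral_congr fun p => ?_
    by_cases hp : p ∈ polarCoord.target
    · have hp' : 0 < p.1 ∧ p.2 ∈ Ioo (-π) π := by simpa [polarCoord_target] using hp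
      rw [indicator_of_mem hp]
      by_cases h1 : p.1 < 1
      · have hmem : polarCoord.symm p ∈ unitDisc := by
          change _ ^ 2 + _ ^ 2 < (1 : ℝ)
          rw [hsq]; nlinarith
        have hmem' : p ∈ Ioo (0 : ℝ) 1 ×ˢ Ioo (-π) π := ⟨⟨hp'.1, h1⟩, hp'.2⟩
        rw [indicator_of_mem hmem, indicator_of_mem hmem', htoC, sub_sub, hsq, hG]
        simp only [smul_eq_mul]
        rw [ENNReal.ofReal_mul hp'.1.le]; ring
      · have hmem : polarCoord.symm p ∉ unitDisc := by
          change ¬ (_ ^ 2 + _ ^ 2 < (1 : ℝ))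
          rw [hsq]; nlinarith
        rw [indicator_of_notMem hmem, indicator_of_notMem (fun hh => h1 hh.1.2), smul_zero]
    · rw [indicator_of_notMem hp, indicator_of_notMem]
      intro hh
      exact hp ⟨hh.1.1, hh.2⟩
  rw [h1, Measure.volume_eq_prod, ← Measure.prod_restrict, lintegral_prod]
  · refine lintegral_congr fun r => ?_
    simp only [hG]
    rw [lintegral_const_mul' _ _ ENNReal.ofReal_ne_top]
  · rw [Measure.prod_restrict]
    refine ContinuousOn.aemeasurable ?_ (measurableSet_Ioo.prod measurableSet_Ioo)
    have hc : ContinuousOn (fun p : ℝ × ℝ => h (p.1 * Complex.exp (p.2 * Complex.I)))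
        (Ioo (0 : ℝ) 1 ×ˢ Ioo (-π) π) := by
      refine hh.comp (by fun_prop) fun p hp => ?_
      rw [mem_ball_zero_iff, norm_mul, Complex.norm_exp_ofReal_mul_I, mul_one, Complex.norm_real,
        Real.norm_of_nonneg hp.1.1.le]
      exact hp.1.2
    intro p hp
    refine ENNReal.Tendsto.mul ?_ (Or.inl ?_) (hc p hp) (Or.inr ENNReal.ofReal_ne_top)
    · exact (ENNReal.continuous_ofReal.comp (by fun_prop : Continuous fun p : ℝ × ℝ =>
        p.1 * (1 - p.1 ^ 2))).continuousAt.continuousWithinAt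
    · have := hp.1.1
      have := hp.1.2
      rw [Ne, ENNReal.ofReal_eq_zero, not_le]
      exact mul_pos (by linarith) (by nlinarith)

lemma lintegral_radial (n : ℕ) :
    ∫⁻ r in Ioo (0 : ℝ) 1, ENNReal.ofReal (r * (1 - r ^ 2) * r ^ (2 * n))
      = ENNReal.ofReal (1 / (2 * ((n + 1) * (n + 2)))) := by
  rw [← ofReal_integral_eq_lintegral_ofReal, ← integral_Ioc_eq_integral_Ioo,
    ← intervalIntegral.integral_of_le zero_le_one]
  · congr 1
    have : ∀ r : ℝ, r * (1 - r ^ 2) * r ^ (2 * n) = r ^ (2 * n + 1) - r ^ (2 * n + 3) := by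
      intro r; ring
    simp_rw [this]
    rw [intervalIntegral.integral_sub (by simp) (by simp), integral_pow, integral_pow]
    push_cast
    simp
    field_simp
    ring
  · exact ((by fun_prop : Continuous fun r : ℝ => r * (1 - r ^ 2) * r ^ (2 * n)).integrableOn_Icc
      (a := 0) (b := 1)).mono_set Ioo_subset_Icc_self
  · refine (ae_restrict_iff' measurableSet_Ioo).2 (Eventually.of_forall fun r hr => ?_)
    have : 0 ≤ 1 - r ^ 2 := by nlinarith [hr.1, hr.2]
    have := hr.1.le
    simp only [Pi.zero_apply]
    positivity

lemma ConvOn.lintegral_disc_sq {c : ℕ → ℂ} (hc : ConvOn c 1) :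
    ∫⁻ p, ‖powSum c (toC p)‖ₑ ^ 2 ∂discMeasure
      = ENNReal.ofReal π * ∑' n : ℕ, ENNReal.ofReal (1 / ((n + 1) * (n + 2))) * ‖c n‖ₑ ^ 2 := by
  rw [lintegral_discMeasure_polar (h := fun z => ‖powSum c z‖ₑ ^ 2)
    ((ENNReal.continuous_pow 2).comp_continuousOn hc.continuousOn.enorm)]
  have h1 : ∀ r ∈ Ioo (0 : ℝ) 1, ENNReal.ofReal (r * (1 - r ^ 2)) *
      ∫⁻ θ in Ioo (-π) π, ‖powSum c (r * Complex.exp (θ * Complex.I))‖ₑ ^ 2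
      = ∑' n, ENNReal.ofReal (r * (1 - r ^ 2) * r ^ (2 * n)) *
          (ENNReal.ofReal (2 * π) * ‖c n‖ₑ ^ 2) := by
    intro r hr
    have hd : Summable fun n => ‖(r : ℂ) ^ n * c n‖ := by
      simpa [abs_of_pos hr.1] using hc r hr.1.le hr.2
    have h2 : ∀ z, powSum c (r * z) = powSum (fun n => (r : ℂ) ^ n * c n) z := by
      intro z
      refine tsum_congr fun n => ?_
      rw [mul_pow]; ring
    simp_rw [h2]
    rw [lintegral_circle_sq hd, ← ENNReal.tsum_mul_left, ← ENNReal.tsum_mul_left]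
    refine tsum_congr fun n => ?_
    have h3 : 0 ≤ r * (1 - r ^ 2) := mul_nonneg hr.1.le (by nlinarith [hr.1, hr.2])
    rw [ENNReal.ofReal_mul h3, enorm_mul, mul_pow, ← ofReal_norm ((r : ℂ) ^ n),
      ← ENNReal.ofReal_pow (norm_nonneg _), norm_pow, Complex.norm_real,
      Real.norm_of_nonneg hr.1.le, ← pow_mul, mul_comm n 2]
    ring
  rw [setLIntegral_congr_fun measurableSet_Ioo h1, lintegral_tsum (fun n => by fun_prop),
    ← ENNReal.tsum_mul_left]
  refine tsum_congr fun n => ?_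
  have h3 : ENNReal.ofReal (1 / (2 * ((n + 1) * (n + 2)))) * ENNReal.ofReal (2 * π)
      = ENNReal.ofReal π * ENNReal.ofReal (1 / ((n + 1) * (n + 2))) := by
    rw [← ENNReal.ofReal_mul (by positivity), ← ENNReal.ofReal_mul (by positivity)]
    congr 1
    field_simp
  rw [lintegral_mul_const _ (by fun_prop), lintegral_radial, ← mul_assoc, h3, mul_assoc]

lemma _root_.HasSum.congr_terms {ι α : Type*} [AddCommMonoid α] [TopologicalSpace α] {f g : ι → α}
    {a : α} (h : HasSum f a) (e : ∀ i, g i = f i) : HasSum g a := by rwa [funext e]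

lemma enorm_sq_eq_ofReal {E : Type*} [NormedAddCommGroup E] (x : E) :
    ‖x‖ₑ ^ 2 = ENNReal.ofReal (‖x‖ ^ 2) := by
  rw [← ofReal_norm, ENNReal.ofReal_pow (norm_nonneg _)]

/-- The easy half of the Littlewood–Paley identity. -/
lemma lintegral_deriv_sq_le {F : ℂ → ℂ} {R : ℝ} (hR : 1 < R)
    (hF : DifferentiableOn ℂ F (Metric.ball 0 R)) :
    ∫⁻ p, ‖deriv F (toC p)‖ₑ ^ 2 ∂discMeasure
      ≤ ENNReal.ofReal (1 / 2) *
        ∫⁻ θ in Ioo (-π) π, ‖F (Complex.exp (θ * Complex.I))‖ₑ ^ 2 := by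
  set c : ℕ → ℂ := fun n => (n.factorial : ℂ)⁻¹ * iteratedDeriv n F 0 with hc
  have hs : ∀ z : ℂ, ‖z‖ < R → HasSum (fun n => c n * z ^ n) (F z) := by
    intro z hz
    have := Complex.hasSum_taylorSeries_on_ball hF (mem_ball_zero_iff.2 hz)
    simp only [sub_zero, smul_eq_mul] at this
    refine this.congr_terms fun n => ?_
    rw [hc]
    ring
  have hconv : ConvOn c R := by
    intro r h0 hr
    have := (hs r (by simpa [abs_of_nonneg h0] using hr)).summable.norm
    simpa [abs_of_nonneg h0, mul_comm] using this
  have hFc : ∀ z : ℂ, ‖z‖ < R → F z = powSum c z := fun z hz => (hs z hz).tsum_eq.symm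
  have hderiv : ∀ p ∈ unitDisc, deriv F (toC p) = powSum (derivCoeff c) (toC p) := by
    intro p hp
    have hlt : ‖toC p‖ < R := (norm_toC_lt hp).trans hR
    rw [← hconv.deriv_powSum hlt]
    refine EventuallyEq.deriv_eq ?_
    filter_upwards [Metric.isOpen_ball.mem_nhds (mem_ball_zero_iff.2 hlt)] with z hz
    exact hFc z (mem_ball_zero_iff.1 hz)
  rw [lintegral_discMeasure_congr (g := fun p => ‖powSum (derivCoeff c) (toC p)‖ₑ ^ 2)
    (fun p hp => by rw [hderiv p hp]), (hconv.derivCoeff.mono hR.le).lintegral_disc_sq]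
  have hcirc : ∀ θ : ℝ, F (Complex.exp (θ * Complex.I)) = powSum c (Complex.exp (θ * Complex.I)) :=
    fun θ => hFc _ (by rwa [Complex.norm_exp_ofReal_mul_I])
  simp_rw [hcirc]
  rw [lintegral_circle_sq (by simpa using hconv 1 zero_le_one hR), ← mul_assoc,
    ← ENNReal.ofReal_mul (by norm_num), show 1 / 2 * (2 * π) = π by ring]
  refine mul_le_mul' le_rfl ?_
  refine (ENNReal.tsum_le_tsum fun n => ?_).trans
    (ENNReal.tsum_comp_le_tsum_of_injective (add_left_injective 1) fun n => ‖c n‖ₑ ^ 2)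
  rw [enorm_sq_eq_ofReal, enorm_sq_eq_ofReal, ← ENNReal.ofReal_mul (by positivity)]
  refine ENNReal.ofReal_le_ofReal ?_
  have : ‖derivCoeff c n‖ = (n + 1) * ‖c (n + 1)‖ := by
    rw [derivCoeff, norm_mul]
    congr 1
    exact_mod_cast Complex.norm_natCast (n + 1)
  rw [this, mul_pow, ← mul_assoc]
  refine mul_le_of_le_one_left (by positivity) ?_
  rw [one_div, inv_mul_le_iff₀ (by positivity)]
  nlinarith [(n.cast_nonneg : (0 : ℝ) ≤ n)]

lemma hasSum_exp_series (s : ℝ) : HasSum (fun k : ℕ => s ^ k / k.factorial) (rexp s) := by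
  have := NormedSpace.expSeries_div_hasSum_exp (𝔸 := ℝ) s
  rwa [← Real.exp_eq_exp_ℝ] at this

lemma hasSum_exp_series_deriv (s : ℝ) :
    HasSum (fun k : ℕ => k * s ^ (k - 1) / k.factorial) (rexp s) := by
  rw [← hasSum_nat_add_iff' 1]
  simp only [Finset.range_one, Finset.sum_singleton, Nat.cast_zero, zero_mul, zero_div, sub_zero]
  refine (hasSum_exp_series s).congr_terms fun k => ?_
  rw [Nat.factorial_succ]
  rw [add_tsub_cancel_right]
  push_cast
  rw [mul_div_mul_left _ _ (by positivity)]

lemma hasSum_exp_series_sq (s : ℝ) :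
    HasSum (fun k : ℕ => k ^ 2 * s ^ (k - 1) / k.factorial) ((1 + s) * rexp s) := by
  rw [← hasSum_nat_add_iff' 1]
  simp only [Finset.range_one, Finset.sum_singleton, Nat.cast_zero]
  rw [zero_pow two_ne_zero, zero_mul, zero_div, sub_zero, one_add_mul]
  refine ((hasSum_exp_series s).add
    ((hasSum_exp_series_deriv s).mul_left s)).congr_terms fun k => ?_
  rw [Nat.factorial_succ, add_tsub_cancel_right]
  have h : s * (k * s ^ (k - 1) / k.factorial) = k * s ^ k / k.factorial := by
    cases k with
    | zero => simp
    | succ m => rw [add_tsub_cancel_right, pow_succ]; ring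
  rw [h]
  push_cast
  field_simp
  ring

lemma hasSum_norm_sq_exp (g t : ℂ) :
    HasSum (fun k : ℕ => ‖g * t ^ k / (√(k.factorial) : ℝ)‖ ^ 2) (‖g‖ ^ 2 * rexp (‖t‖ ^ 2)) := by
  refine ((hasSum_exp_series (‖t‖ ^ 2)).mul_left (‖g‖ ^ 2)).congr_terms fun k => ?_
  rw [norm_div, Complex.norm_real, Real.norm_of_nonneg (Real.sqrt_nonneg _), div_pow,
    Real.sq_sqrt (by positivity), norm_mul, norm_pow]
  ring

lemma exists_hasSum_norm_sq_deriv_exp (x y t : ℂ) :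
    ∃ S, HasSum (fun k : ℕ => ‖(x * t ^ k + k * y * t ^ (k - 1)) / (√(k.factorial) : ℝ)‖ ^ 2) S ∧
      ‖y‖ ^ 2 * rexp (‖t‖ ^ 2) ≤ S := by
  set s := ‖t‖ ^ 2 with hs
  set ρ := (x * (starRingEnd ℂ) y * t).re with hρ
  refine ⟨‖x‖ ^ 2 * rexp s + 2 * ρ * rexp s + ‖y‖ ^ 2 * ((1 + s) * rexp s), ?_, ?_⟩
  · refine ((((hasSum_exp_series s).mul_left (‖x‖ ^ 2)).add
      ((hasSum_exp_series_deriv s).mul_left (2 * ρ))).add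
      ((hasSum_exp_series_sq s).mul_left (‖y‖ ^ 2))).congr_terms fun k => ?_
    rw [norm_div, Complex.norm_real, Real.norm_of_nonneg (Real.sqrt_nonneg _), div_pow,
      Real.sq_sqrt (by positivity), ← Complex.normSq_eq_norm_sq, Complex.normSq_add,
      Complex.normSq_eq_norm_sq, Complex.normSq_eq_norm_sq]
    have h : (x * t ^ k * (starRingEnd ℂ) (k * y * t ^ (k - 1))).re = ρ * (k * s ^ (k - 1)) := by
      cases k with
      | zero => simp
      | succ m =>
        have : x * t ^ (m + 1) * (starRingEnd ℂ) (((m + 1 : ℕ) : ℂ) * y * t ^ (m + 1 - 1))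
            = ((((m + 1 : ℕ) : ℝ) * s ^ m : ℝ) : ℂ) * (x * (starRingEnd ℂ) y * t) := by
          rw [add_tsub_cancel_right, hs]
          push_cast
          rw [← Complex.mul_conj']
          simp only [map_mul, map_pow, map_add, map_natCast, map_one]
          ring
        rw [this, Complex.re_ofReal_mul, add_tsub_cancel_right]
        ring
    rw [h]
    simp only [norm_mul, norm_pow, Complex.norm_natCast]
    rw [hs]
    ring
  · have h : 0 ≤ ‖x + (starRingEnd ℂ) t * y‖ ^ 2 := by positivity
    rw [← Complex.normSq_eq_norm_sq, Complex.normSq_add] at h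
    have h2 : x * (starRingEnd ℂ) ((starRingEnd ℂ) t * y) = x * (starRingEnd ℂ) y * t := by
      simp only [map_mul, Complex.conj_conj]; ring
    rw [h2, ← hρ, Complex.normSq_eq_norm_sq, Complex.normSq_eq_norm_sq, norm_mul,
      RCLike.norm_conj, mul_pow, ← hs] at h
    nlinarith [mul_nonneg h (Real.exp_pos s).le]

lemma lintegral_mul_deriv_sq_le {f β H : ℂ → ℂ} {R M : ℝ} (hR : 1 < R)
    (hf : DifferentiableOn ℂ f (Metric.ball 0 R)) (hβ : DifferentiableOn ℂ β (Metric.ball 0 R))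
    (hH : DifferentiableOn ℂ H (Metric.ball 0 R))
    (hcirc : ∀ z, ‖z‖ = 1 → ‖β z‖ ^ 2 ≤ 2 * (H z).re)
    (hdisc : ∀ z, ‖z‖ < 1 → 2 * (H z).re - M ≤ ‖β z‖ ^ 2) :
    ∫⁻ p, ‖f (toC p)‖ₑ ^ 2 * ‖deriv β (toC p)‖ₑ ^ 2 ∂discMeasure
      ≤ ENNReal.ofReal (rexp M) * (ENNReal.ofReal (1 / 2) *
        ∫⁻ θ in Ioo (-π) π, ‖f (Complex.exp (θ * Complex.I))‖ₑ ^ 2) := by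
  set G : ℂ → ℂ := fun z => f z * Complex.exp (-H z) with hGdef
  have hG : DifferentiableOn ℂ G (Metric.ball 0 R) := hf.mul hH.neg.cexp
  set F : ℕ → ℂ → ℂ := fun k z => G z * β z ^ k / (√(k.factorial) : ℝ) with hFdef
  have hF : ∀ k, DifferentiableOn ℂ (F k) (Metric.ball 0 R) := fun k =>
    (hG.mul (hβ.pow k)).div_const _
  have hnG : ∀ z, ‖G z‖ ^ 2 = ‖f z‖ ^ 2 * rexp (-(2 * (H z).re)) := by
    intro z
    rw [hGdef]
    simp only
    rw [norm_mul, Complex.norm_exp, mul_pow, ← Real.exp_nat_mul, Complex.neg_re]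
    congr 2
    push_cast; ring
  have hderiv : ∀ k z, ‖z‖ < R → deriv (F k) z
      = (deriv G z * β z ^ k + k * (G z * deriv β z) * β z ^ (k - 1)) / (√(k.factorial) : ℝ) := by
    intro k z hz
    have hmem := Metric.isOpen_ball.mem_nhds (mem_ball_zero_iff.2 hz)
    have h1 := (hG.differentiableAt hmem).hasDerivAt
    have h2 := (hβ.differentiableAt hmem).hasDerivAt
    have h3 := (h1.mul (h2.pow k)).div_const ((√(k.factorial) : ℝ) : ℂ)
    have h4 : F k = fun z => (G * β ^ k) z / ((√(k.factorial) : ℝ) : ℂ) := rfl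
    rw [h4, h3.deriv]
    simp only [Pi.pow_apply]
    ring
  have hlower : ∀ p ∈ unitDisc, ENNReal.ofReal (rexp (-M)) *
      (‖f (toC p)‖ₑ ^ 2 * ‖deriv β (toC p)‖ₑ ^ 2) ≤ ∑' k, ‖deriv (F k) (toC p)‖ₑ ^ 2 := by
    intro p hp
    have hz := norm_toC_lt hp
    set z := toC p
    obtain ⟨S, hS, hle⟩ := exists_hasSum_norm_sq_deriv_exp (deriv G z) (G z * deriv β z) (β z)
    simp_rw [enorm_sq_eq_ofReal, hderiv _ z (hz.trans hR)]
    rw [← ENNReal.ofReal_tsum_of_nonneg (fun k => by positivity) hS.summable, hS.tsum_eq,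
      ← ENNReal.ofReal_mul (by positivity), ← ENNReal.ofReal_mul (by positivity)]
    refine ENNReal.ofReal_le_ofReal (le_trans ?_ hle)
    rw [norm_mul, mul_pow, hnG]
    have : rexp (-M) ≤ rexp (-(2 * (H z).re)) * rexp (‖β z‖ ^ 2) := by
      rw [← Real.exp_add]
      exact Real.exp_le_exp.2 (by linarith [hdisc z hz])
    calc rexp (-M) * (‖f z‖ ^ 2 * ‖deriv β z‖ ^ 2)
        ≤ rexp (-(2 * (H z).re)) * rexp (‖β z‖ ^ 2) * (‖f z‖ ^ 2 * ‖deriv β z‖ ^ 2) := by gcongr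
      _ = _ := by ring
  have hupper : ∀ θ : ℝ, ∑' k, ‖F k (Complex.exp (θ * Complex.I))‖ₑ ^ 2
      ≤ ‖f (Complex.exp (θ * Complex.I))‖ₑ ^ 2 := by
    intro θ
    have hz := Complex.norm_exp_ofReal_mul_I θ
    set z := Complex.exp (θ * Complex.I)
    have hS := hasSum_norm_sq_exp (G z) (β z)
    simp_rw [enorm_sq_eq_ofReal]
    rw [← ENNReal.ofReal_tsum_of_nonneg (fun k => by positivity) hS.summable, hS.tsum_eq]
    refine ENNReal.ofReal_le_ofReal ?_
    rw [hnG, mul_assoc, ← Real.exp_add]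
    refine mul_le_of_le_one_right (by positivity) ?_
    rw [Real.exp_le_one_iff]
    linarith [hcirc z hz]
  have hmeas1 : ∀ k, AEMeasurable (fun p => ‖deriv (F k) (toC p)‖ₑ ^ 2) discMeasure := by
    intro k
    have h : ContinuousOn (deriv (F k)) (Metric.ball 0 1) :=
      (((hF k).deriv Metric.isOpen_ball).continuousOn).mono (Metric.ball_subset_ball hR.le)
    exact (aemeasurable_discMeasure h).enorm.pow_const 2
  have hmeas2 : ∀ k, AEMeasurable (fun θ : ℝ => ‖F k (Complex.exp (θ * Complex.I))‖ₑ ^ 2)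
      (volume.restrict (Ioo (-π) π)) := by
    intro k
    have h : Continuous fun θ : ℝ => F k (Complex.exp (θ * Complex.I)) :=
      (hF k).continuousOn.comp_continuous (by fun_prop) fun θ => by
        rwa [mem_ball_zero_iff, Complex.norm_exp_ofReal_mul_I]
    exact h.measurable.enorm.pow_const 2 |>.aemeasurable
  have hmain : ENNReal.ofReal (rexp (-M)) *
      ∫⁻ p, ‖f (toC p)‖ₑ ^ 2 * ‖deriv β (toC p)‖ₑ ^ 2 ∂discMeasure
      ≤ ENNReal.ofReal (1 / 2) *
        ∫⁻ θ in Ioo (-π) π, ‖f (Complex.exp (θ * Complex.I))‖ₑ ^ 2 := by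
    rw [← lintegral_const_mul' _ _ ENNReal.ofReal_ne_top]
    calc _ ≤ ∫⁻ p, ∑' k, ‖deriv (F k) (toC p)‖ₑ ^ 2 ∂discMeasure :=
          lintegral_discMeasure_mono hlower
      _ = ∑' k, ∫⁻ p, ‖deriv (F k) (toC p)‖ₑ ^ 2 ∂discMeasure := lintegral_tsum hmeas1
      _ ≤ ∑' k, ENNReal.ofReal (1 / 2) *
            ∫⁻ θ in Ioo (-π) π, ‖F k (Complex.exp (θ * Complex.I))‖ₑ ^ 2 :=
          ENNReal.tsum_le_tsum fun k => lintegral_deriv_sq_le hR (hF k)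
      _ = ENNReal.ofReal (1 / 2) *
            ∫⁻ θ in Ioo (-π) π, ∑' k, ‖F k (Complex.exp (θ * Complex.I))‖ₑ ^ 2 := by
          rw [ENNReal.tsum_mul_left, lintegral_tsum hmeas2]
      _ ≤ _ := by
          gcongr with θ
          exact hupper θ
  calc _ = ENNReal.ofReal (rexp M) * (ENNReal.ofReal (rexp (-M)) *
        ∫⁻ p, ‖f (toC p)‖ₑ ^ 2 * ‖deriv β (toC p)‖ₑ ^ 2 ∂discMeasure) := by
        rw [← mul_assoc, ← ENNReal.ofReal_mul (by positivity), ← Real.exp_add]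
        simp
    _ ≤ _ := by gcongr

/-- The finite sections of the Hankel matrix `(β (j + k))` are bounded on `ℓ²`, with squared norm
at most `C`. -/
def HankelBound (β : ℕ → ℝ) (C : ℝ) : Prop :=
  ∀ (J N : ℕ) (x : ℕ → ℝ), ∑ j ∈ Finset.range J, (∑ k ∈ Finset.range N, β (j + k) * x k) ^ 2
    ≤ C * ∑ k ∈ Finset.range N, x k ^ 2

lemma HankelBound.dilate {β : ℕ → ℝ} {C ρ : ℝ} (h : HankelBound β C) (hC : 0 ≤ C) (h0 : 0 ≤ ρ)
    (h1 : ρ ≤ 1) : HankelBound (fun n => ρ ^ n * β n) C := by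
  intro J N x
  have hsq : ∀ n, (ρ ^ n) ^ 2 ≤ 1 := fun n => pow_le_one₀ (by positivity) (pow_le_one₀ h0 h1)
  calc ∑ j ∈ Finset.range J, (∑ k ∈ Finset.range N, ρ ^ (j + k) * β (j + k) * x k) ^ 2
      = ∑ j ∈ Finset.range J,
          (ρ ^ j) ^ 2 * (∑ k ∈ Finset.range N, β (j + k) * (ρ ^ k * x k)) ^ 2 := by
        refine Finset.sum_congr rfl fun j _ => ?_
        rw [← mul_pow, Finset.mul_sum]
        congr 1
        refine Finset.sum_congr rfl fun k _ => ?_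
        rw [pow_add]; ring
    _ ≤ ∑ j ∈ Finset.range J, (∑ k ∈ Finset.range N, β (j + k) * (ρ ^ k * x k)) ^ 2 :=
        Finset.sum_le_sum fun j _ => mul_le_of_le_one_left (sq_nonneg _) (hsq j)
    _ ≤ C * ∑ k ∈ Finset.range N, (ρ ^ k * x k) ^ 2 := h J N _
    _ ≤ C * ∑ k ∈ Finset.range N, x k ^ 2 := by
        refine mul_le_mul_of_nonneg_left (Finset.sum_le_sum fun k _ => ?_) hC
        rw [mul_pow]
        exact mul_le_of_le_one_left (sq_nonneg _) (hsq k)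

lemma HankelBound.complex {β : ℕ → ℝ} {C : ℝ} (h : HankelBound β C) (J N : ℕ) (x : ℕ → ℂ) :
    ∑ j ∈ Finset.range J, ‖∑ k ∈ Finset.range N, (β (j + k) : ℂ) * x k‖ ^ 2
      ≤ C * ∑ k ∈ Finset.range N, ‖x k‖ ^ 2 := by
  have e : ∀ z : ℂ, ‖z‖ ^ 2 = z.re ^ 2 + z.im ^ 2 := fun z => by
    rw [← Complex.normSq_eq_norm_sq, Complex.normSq_apply]; ring
  simp_rw [e, Complex.re_sum, Complex.im_sum, Complex.re_ofReal_mul, Complex.im_ofReal_mul,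
    Finset.sum_add_distrib, mul_add]
  exact add_le_add (h J N _) (h J N _)

/-- The power series of the `j`-th row of the Hankel matrix. -/
noncomputable def rowSum (β : ℕ → ℝ) (j : ℕ) : ℂ → ℂ := powSum fun k => (β (j + k) : ℂ)

section Geometric

variable {β : ℕ → ℝ} {K s : ℝ}

lemma hasSum_geometric_row (hs0 : 0 < s) {r : ℝ} (hr0 : 0 ≤ r) (hr : r * s < 1) (j : ℕ) :
    HasSum (fun k : ℕ => K * s ^ j * (r * s) ^ k) (K * s ^ j * (1 - r * s)⁻¹) :=
  (hasSum_geometric_of_lt_one (by positivity) hr).mul_left _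

lemma row_term_le (hβ : ∀ n, |β n| ≤ K * s ^ n) (j k : ℕ) {r : ℝ}
    (hr0 : 0 ≤ r) : r ^ k * ‖(β (j + k) : ℂ)‖ ≤ K * s ^ j * (r * s) ^ k := by
  rw [Complex.norm_real, Real.norm_eq_abs]
  calc r ^ k * |β (j + k)| ≤ r ^ k * (K * s ^ (j + k)) := by gcongr; exact hβ _
    _ = _ := by rw [pow_add, mul_pow]; ring

lemma convOn_row (hβ : ∀ n, |β n| ≤ K * s ^ n) (hs0 : 0 < s) {R : ℝ} (hR : R * s < 1) (j : ℕ) :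
    ConvOn (fun k => (β (j + k) : ℂ)) R := by
  intro r h0 hr
  exact Summable.of_nonneg_of_le (fun k => by positivity) (fun k => row_term_le hβ j k h0)
    (hasSum_geometric_row hs0 h0 (lt_trans (by gcongr) hR) j).summable

lemma norm_rowSum_le (hβ : ∀ n, |β n| ≤ K * s ^ n) (hs0 : 0 < s) {r : ℝ} (hr : r * s < 1)
    {z : ℂ} (hz : ‖z‖ ≤ r) (j : ℕ) : ‖rowSum β j z‖ ≤ K * s ^ j * (1 - r * s)⁻¹ := by
  have h0 : 0 ≤ r := (norm_nonneg z).trans hz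
  refine tsum_of_norm_bounded (hasSum_geometric_row hs0 h0 hr j) fun k => ?_
  refine le_trans ?_ (row_term_le hβ j k h0)
  rw [norm_mul, norm_pow, mul_comm]
  gcongr

lemma rowSum_succ (hβ : ∀ n, |β n| ≤ K * s ^ n) (hs0 : 0 < s) {R : ℝ} (hR : R * s < 1)
    {z : ℂ} (hz : ‖z‖ < R) (j : ℕ) : rowSum β j z = β j + z * rowSum β (j + 1) z := by
  have h := ((convOn_row hβ hs0 hR j).hasSum hz).summable
  rw [rowSum, powSum, h.tsum_eq_zero_add, rowSum, powSum, ← tsum_mul_left]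
  congr 1
  · simp
  · refine tsum_congr fun k => ?_
    rw [show j + 1 + k = j + (k + 1) by ring]
    ring

lemma hankel_rowSum_le {C : ℝ} (h : HankelBound β C) (hC : 0 ≤ C) (hβ : ∀ n, |β n| ≤ K * s ^ n)
    (hs0 : 0 < s) (hs1 : s < 1) {z : ℂ} (hz : ‖z‖ < 1) (J : ℕ) :
    ∑ j ∈ Finset.range J, ‖rowSum β j z‖ ^ 2 ≤ C * (1 - ‖z‖ ^ 2)⁻¹ := by
  have ht : Tendsto (fun N => ∑ j ∈ Finset.range J,
      ‖∑ k ∈ Finset.range N, (β (j + k) : ℂ) * z ^ k‖ ^ 2) atTop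
      (𝓝 (∑ j ∈ Finset.range J, ‖rowSum β j z‖ ^ 2)) := by
    refine tendsto_finsetSum _ fun j _ => ?_
    exact (((convOn_row hβ hs0 (R := 1) (by linarith) j).hasSum hz).tendsto_sum_nat.norm).pow 2
  refine le_of_tendsto' ht fun N => (h.complex J N _).trans ?_
  gcongr
  have hz2 : ‖z‖ ^ 2 < 1 := by nlinarith [norm_nonneg z]
  have := sum_le_hasSum (Finset.range N) (fun _ _ => by positivity)
    (hasSum_geometric_of_lt_one (sq_nonneg ‖z‖) hz2)
  refine le_trans (le_of_eq ?_) this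
  refine Finset.sum_congr rfl fun k _ => ?_
  rw [norm_pow, ← pow_mul, ← pow_mul, mul_comm]

/-- A holomorphic function whose real part is half of the Poisson extension of `|β|²`. -/
noncomputable def poissonHol (β : ℕ → ℝ) (z : ℂ) : ℂ :=
  ∑' j, β j * rowSum β j z - ((1 / 2 * ∑' j, β j ^ 2 : ℝ) : ℂ)

lemma norm_mul_rowSum_le (hβ : ∀ n, |β n| ≤ K * s ^ n) (hs0 : 0 < s) {r : ℝ}
    (hr : r * s < 1) {z : ℂ} (hz : ‖z‖ ≤ r) (j : ℕ) :
    ‖β j * rowSum β j z‖ ≤ K ^ 2 * (1 - r * s)⁻¹ * (s ^ 2) ^ j := by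
  have hK : 0 ≤ K * s ^ j := (abs_nonneg _).trans (hβ j)
  rw [norm_mul, Complex.norm_real, Real.norm_eq_abs]
  calc |β j| * ‖rowSum β j z‖ ≤ (K * s ^ j) * (K * s ^ j * (1 - r * s)⁻¹) :=
        mul_le_mul (hβ j) (norm_rowSum_le hβ hs0 hr hz j) (norm_nonneg _) hK
    _ = _ := by rw [← pow_mul, mul_comm 2 j, pow_mul]; ring

lemma summable_geometric_sq (hs0 : 0 < s) (hs1 : s < 1) (A : ℝ) :
    Summable fun j : ℕ => A * (s ^ 2) ^ j :=
  (summable_geometric_of_lt_one (sq_nonneg s) (by nlinarith)).mul_left _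

lemma poissonHol_differentiableOn (hβ : ∀ n, |β n| ≤ K * s ^ n) (hs0 : 0 < s) (hs1 : s < 1)
    {R : ℝ} (hR : R * s < 1) : DifferentiableOn ℂ (poissonHol β) (Metric.ball 0 R) := by
  refine DifferentiableOn.sub_const ?_ _
  refine Complex.differentiableOn_tsum_of_summable_norm
    (summable_geometric_sq hs0 hs1 (K ^ 2 * (1 - R * s)⁻¹)) (fun j => ?_) Metric.isOpen_ball
    fun j w hw => norm_mul_rowSum_le hβ hs0 hR (mem_ball_zero_iff.1 hw).le j
  exact (convOn_row hβ hs0 hR j).differentiableOn.const_mul _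

lemma poissonHol_re (hβ : ∀ n, |β n| ≤ K * s ^ n) (hs0 : 0 < s) (hs1 : s < 1) {z : ℂ}
    (hz : ‖z‖ ≤ 1) : Summable (fun j => ‖rowSum β (j + 1) z‖ ^ 2) ∧
      2 * (poissonHol β z).re - ‖rowSum β 0 z‖ ^ 2
        = (1 - ‖z‖ ^ 2) * ∑' j, ‖rowSum β (j + 1) z‖ ^ 2 := by
  have hr : 1 * s < 1 := by linarith
  obtain ⟨R, hR1, hR2⟩ := exists_between ((one_lt_inv₀ hs0).2 hs1)
  have hRs : R * s < 1 := by
    rwa [lt_inv_comm₀ (by linarith) hs0, ← one_div, lt_div_iff₀ (by linarith), mul_comm] at hR2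
  have hS : Summable fun j => ‖rowSum β j z‖ ^ 2 := by
    refine Summable.of_nonneg_of_le (fun j => by positivity) (fun j => ?_)
      (summable_geometric_sq hs0 hs1 (K ^ 2 * (1 - 1 * s)⁻¹ ^ 2))
    calc ‖rowSum β j z‖ ^ 2 ≤ (K * s ^ j * (1 - 1 * s)⁻¹) ^ 2 := by
          gcongr; exact norm_rowSum_le hβ hs0 hr hz j
      _ = _ := by rw [← pow_mul, mul_comm 2 j, pow_mul]; ring
  have hB : Summable fun j => β j ^ 2 := by
    refine Summable.of_nonneg_of_le (fun j => by positivity) (fun j => ?_)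
      (summable_geometric_sq hs0 hs1 (K ^ 2))
    calc β j ^ 2 = |β j| ^ 2 := (sq_abs _).symm
      _ ≤ (K * s ^ j) ^ 2 := by gcongr; exact hβ j
      _ = _ := by rw [← pow_mul, mul_comm 2 j, pow_mul]; ring
  have hP : Summable fun j => (β j : ℂ) * rowSum β j z :=
    Summable.of_norm_bounded (summable_geometric_sq hs0 hs1 (K ^ 2 * (1 - 1 * s)⁻¹))
      fun j => norm_mul_rowSum_le hβ hs0 hr hz j
  have hS1 : Summable fun j => ‖rowSum β (j + 1) z‖ ^ 2 := (summable_nat_add_iff 1).2 hS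
  refine ⟨hS1, ?_⟩
  have hPre : HasSum (fun j => β j * (rowSum β j z).re) (∑' j, (β j : ℂ) * rowSum β j z).re := by
    simpa using Complex.hasSum_re hP.hasSum
  have h1 : HasSum (fun j => ‖z‖ ^ 2 * ‖rowSum β (j + 1) z‖ ^ 2)
      (∑' j, ‖rowSum β j z‖ ^ 2 - 2 * (∑' j, (β j : ℂ) * rowSum β j z).re + ∑' j, β j ^ 2) := by
    refine ((hS.hasSum.sub (hPre.mul_left 2)).add hB.hasSum).congr_terms fun j => ?_
    have h2 : z * rowSum β (j + 1) z = rowSum β j z - β j := by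
      rw [rowSum_succ hβ hs0 hRs (hz.trans_lt hR1) j]; ring
    rw [← mul_pow, ← norm_mul, h2, ← Complex.normSq_eq_norm_sq, ← Complex.normSq_eq_norm_sq,
      Complex.normSq_sub, Complex.normSq_ofReal, Complex.conj_ofReal, Complex.re_mul_ofReal]
    ring
  have h3 := h1.unique (hS1.hasSum.mul_left _)
  have h4 := hS.tsum_eq_zero_add
  rw [poissonHol, Complex.sub_re, Complex.ofReal_re]
  linarith

/-- The Carleson embedding for a symbol whose coefficients decay geometrically. -/
lemma carleson_of_hankelBound_geometric {C : ℝ} (h : HankelBound β C) (hC : 0 ≤ C)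
    (hβ : ∀ n, |β n| ≤ K * s ^ n) (hs0 : 0 < s) (hs1 : s < 1) {a : ℕ → ℂ} {R : ℝ} (hR : 1 < R)
    (ha : ConvOn a R) :
    ∫⁻ p, ‖powSum a (toC p)‖ₑ ^ 2 * ‖powSum (derivCoeff fun n => (β n : ℂ)) (toC p)‖ₑ ^ 2
        ∂discMeasure ≤ ENNReal.ofReal (rexp C * π) * ∑' n, ‖a n‖ₑ ^ 2 := by
  obtain ⟨R₁, hR1, hR2⟩ := exists_between ((one_lt_inv₀ hs0).2 hs1)
  have hRs : R₁ * s < 1 := by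
    rwa [lt_inv_comm₀ (by linarith) hs0, ← one_div, lt_div_iff₀ (by linarith), mul_comm] at hR2
  set R₂ := min R R₁
  have hR₂ : 1 < R₂ := lt_min hR hR1
  have hR₂s : R₂ * s < 1 := lt_of_le_of_lt (by gcongr; exact min_le_right _ _) hRs
  have ha₂ : ConvOn a R₂ := ha.mono (min_le_left _ _)
  have hβc : ConvOn (fun n => (β n : ℂ)) R₂ := by
    simpa using convOn_row hβ hs0 hR₂s 0
  have hrow0 : ∀ z, rowSum β 0 z = powSum (fun n => (β n : ℂ)) z := fun z => by simp [rowSum]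
  have key := lintegral_mul_deriv_sq_le (M := C) hR₂ ha₂.differentiableOn hβc.differentiableOn
    (poissonHol_differentiableOn hβ hs0 hs1 hR₂s) (fun z hz => ?_) (fun z hz => ?_)
  · rw [lintegral_discMeasure_congr (g := fun p => ‖powSum a (toC p)‖ₑ ^ 2 *
      ‖deriv (powSum fun n => (β n : ℂ)) (toC p)‖ₑ ^ 2) fun p hp => by
        rw [hβc.deriv_powSum ((norm_toC_lt hp).trans hR₂)]]
    refine key.trans (le_of_eq ?_)
    rw [lintegral_circle_sq (by simpa using ha₂ 1 zero_le_one hR₂), ← mul_assoc, ← mul_assoc,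
      ← ENNReal.ofReal_mul (by positivity), ← ENNReal.ofReal_mul (by positivity)]
    congr 2
    ring
  · have := (poissonHol_re hβ hs0 hs1 hz.le).2
    rw [hz, hrow0] at this
    linarith
  · obtain ⟨hsum, heq⟩ := poissonHol_re hβ hs0 hs1 hz.le
    have hz2 : 0 < 1 - ‖z‖ ^ 2 := by nlinarith [norm_nonneg z]
    have hle : ∑' j, ‖rowSum β (j + 1) z‖ ^ 2 ≤ C * (1 - ‖z‖ ^ 2)⁻¹ := by
      refine Real.tsum_le_of_sum_range_le (fun _ => by positivity) fun J => ?_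
      refine le_trans ?_ (hankel_rowSum_le h hC hβ hs0 hs1 hz (J + 1))
      rw [Finset.sum_range_succ']
      exact le_add_of_nonneg_right (by positivity)
    have : (1 - ‖z‖ ^ 2) * ∑' j, ‖rowSum β (j + 1) z‖ ^ 2 ≤ C := by
      calc _ ≤ (1 - ‖z‖ ^ 2) * (C * (1 - ‖z‖ ^ 2)⁻¹) := by gcongr
        _ = C := by field_simp
    rw [hrow0] at heq
    linarith

end Geometric

lemma ConvOn.exists_geometric_bound {c : ℕ → ℂ} (hc : ConvOn c 1) {ρ : ℝ} (h0 : 0 < ρ)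
    (h1 : ρ < 1) : ∃ K, ∀ n, ρ ^ n * ‖c n‖ ≤ K * √ρ ^ n := by
  have hs := hc √ρ (Real.sqrt_nonneg _) (by rw [Real.sqrt_lt' one_pos]; linarith)
  refine ⟨∑' n, √ρ ^ n * ‖c n‖, fun n => ?_⟩
  calc ρ ^ n * ‖c n‖ = √ρ ^ n * ‖c n‖ * √ρ ^ n := by
        nth_rw 1 [← Real.mul_self_sqrt h0.le]
        rw [mul_pow]; ring
    _ ≤ _ := by
        gcongr
        exact hs.le_tsum n fun j _ => by positivity

lemma powSum_dilate (c : ℕ → ℂ) (ρ : ℝ) (z : ℂ) :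
    powSum (fun n => (ρ : ℂ) ^ n * c n) z = powSum c (ρ * z) := by
  refine tsum_congr fun n => ?_
  rw [mul_pow]; ring

lemma powSum_derivCoeff_dilate (c : ℕ → ℂ) (ρ : ℝ) (z : ℂ) :
    powSum (derivCoeff fun n => (ρ : ℂ) ^ n * c n) z = ρ * powSum (derivCoeff c) (ρ * z) := by
  rw [powSum, powSum, ← tsum_mul_left]
  refine tsum_congr fun n => ?_
  rw [mul_pow, derivCoeff, derivCoeff]; ring

lemma ConvOn.dilate {c : ℕ → ℂ} (hc : ConvOn c 1) {ρ : ℝ} (h0 : 0 < ρ) :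
    ConvOn (fun n => (ρ : ℂ) ^ n * c n) ρ⁻¹ := by
  intro r hr0 hr
  have := hc (r * ρ) (by positivity) (by rwa [← lt_inv_mul_iff₀' h0, mul_one])
  refine this.congr fun n => ?_
  rw [norm_mul, norm_pow, Complex.norm_real, Real.norm_of_nonneg h0.le, mul_pow]
  ring

lemma convOn_of_summable_sq {a : ℕ → ℂ} (ha : Summable fun n => ‖a n‖ ^ 2) : ConvOn a 1 := by
  intro r h0 h1
  have hg : Summable fun n : ℕ => (r ^ 2) ^ n :=
    summable_geometric_of_lt_one (sq_nonneg r) (by nlinarith)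
  refine Summable.of_nonneg_of_le (fun n => by positivity) (fun n => ?_) (hg.add ha)
  rw [← pow_mul, mul_comm 2 n, pow_mul]
  nlinarith [sq_nonneg (r ^ n - ‖a n‖), sq_nonneg (r ^ n), sq_nonneg (‖a n‖)]

lemma carleson_of_hankelBound {β : ℕ → ℝ} {C : ℝ} (h : HankelBound β C) (hC : 0 ≤ C)
    (hβ : ConvOn (fun n => (β n : ℂ)) 1) {a : ℕ → ℂ} (ha : Summable fun n => ‖a n‖ ^ 2) :
    ∫⁻ p, ‖powSum a (toC p)‖ₑ ^ 2 * ‖powSum (derivCoeff fun n => (β n : ℂ)) (toC p)‖ₑ ^ 2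
        ∂discMeasure ≤ ENNReal.ofReal (rexp C * π) * ∑' n, ‖a n‖ₑ ^ 2 := by
  have hac := convOn_of_summable_sq ha
  set ρ : ℕ → ℝ := fun m => 1 - 1 / ((m : ℝ) + 2) with hρ
  have hρ0 : ∀ m, 0 < ρ m := fun m => by
    have : 1 / ((m : ℝ) + 2) < 1 := by
      rw [div_lt_one (by positivity)]
      linarith [(m.cast_nonneg : (0 : ℝ) ≤ m)]
    simp only [hρ]; linarith
  have hρ1 : ∀ m, ρ m < 1 := fun m => by
    have : 0 < 1 / ((m : ℝ) + 2) := by positivity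
    simp only [hρ]; linarith
  have hρt : Tendsto ρ atTop (𝓝 1) := by
    have h2 : Tendsto (fun m : ℕ => 1 / ((m : ℝ) + 2)) atTop (𝓝 0) :=
      tendsto_const_nhds.div_atTop (tendsto_natCast_atTop_atTop.atTop_add tendsto_const_nhds)
    have := h2.const_sub 1
    rwa [sub_zero] at this
  set f : ℕ → ℝ × ℝ → ℝ≥0∞ := fun m p => ‖powSum (fun n => (ρ m : ℂ) ^ n * a n) (toC p)‖ₑ ^ 2 *
    ‖powSum (derivCoeff fun n => (ρ m : ℂ) ^ n * (β n : ℂ)) (toC p)‖ₑ ^ 2 with hf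
  have hbound : ∀ m, ∫⁻ p, f m p ∂discMeasure
      ≤ ENNReal.ofReal (rexp C * π) * ∑' n, ‖a n‖ₑ ^ 2 := by
    intro m
    obtain ⟨K, hK⟩ := hβ.exists_geometric_bound (hρ0 m) (hρ1 m)
    have hs0 : 0 < √(ρ m) := Real.sqrt_pos.2 (hρ0 m)
    have hs1 : √(ρ m) < 1 := by rw [Real.sqrt_lt' one_pos]; linarith [hρ1 m]
    have := carleson_of_hankelBound_geometric (h.dilate hC (hρ0 m).le (hρ1 m).le) hC
      (K := K) (s := √(ρ m)) (fun n => ?_) hs0 hs1 ((one_lt_inv₀ (hρ0 m)).2 (hρ1 m))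
      (hac.dilate (hρ0 m))
    · simp only [Complex.ofReal_mul, Complex.ofReal_pow] at this
      refine this.trans ?_
      refine mul_le_mul' le_rfl (ENNReal.tsum_le_tsum fun n => ?_)
      rw [enorm_sq_eq_ofReal, enorm_sq_eq_ofReal]
      refine ENNReal.ofReal_le_ofReal ?_
      rw [norm_mul, norm_pow, Complex.norm_real, Real.norm_of_nonneg (hρ0 m).le, mul_pow]
      exact mul_le_of_le_one_left (by positivity)
        (pow_le_one₀ (pow_nonneg (hρ0 m).le _) (pow_le_one₀ (hρ0 m).le (hρ1 m).le))
    · rw [abs_mul, abs_of_nonneg (pow_nonneg (hρ0 m).le n)]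
      simpa using hK n
  have hlim : ∀ p ∈ unitDisc, Tendsto (fun m => f m p) atTop
      (𝓝 (‖powSum a (toC p)‖ₑ ^ 2 *
        ‖powSum (derivCoeff fun n => (β n : ℂ)) (toC p)‖ₑ ^ 2)) := by
    intro p hp
    have hz := norm_toC_lt hp
    have hnhds := Metric.isOpen_ball.mem_nhds (mem_ball_zero_iff.2 hz)
    have hρz : Tendsto (fun m => (ρ m : ℂ) * toC p) atTop (𝓝 (toC p)) := by
      have : Tendsto (fun m => (ρ m : ℂ)) atTop (𝓝 ((1 : ℝ) : ℂ)) :=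
        (Complex.continuous_ofReal.tendsto 1).comp hρt
      simpa using this.mul_const (toC p)
    have h1 := (hac.continuousOn.continuousAt hnhds).tendsto.comp hρz
    have h2 := (hβ.derivCoeff.continuousOn.continuousAt hnhds).tendsto.comp hρz
    have h3 : Tendsto (fun m => (ρ m : ℂ)) atTop (𝓝 ((1 : ℝ) : ℂ)) :=
      (Complex.continuous_ofReal.tendsto 1).comp hρt
    simp only [hf, powSum_dilate, powSum_derivCoeff_dilate]
    have h4 := h3.mul h2
    rw [Complex.ofReal_one, one_mul] at h4
    exact ENNReal.Tendsto.mul (ENNReal.Tendsto.pow h1.enorm) (Or.inr (by finiteness))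
      (ENNReal.Tendsto.pow h4.enorm) (Or.inr (by finiteness))
  have hmeas : ∀ m, AEMeasurable (f m) discMeasure := by
    intro m
    have hle : 1 ≤ (ρ m)⁻¹ := ((one_lt_inv₀ (hρ0 m)).2 (hρ1 m)).le
    exact ((aemeasurable_discMeasure ((hac.dilate (hρ0 m)).mono hle).continuousOn).enorm.pow_const
      2).mul ((aemeasurable_discMeasure
        ((hβ.dilate (hρ0 m)).mono hle).derivCoeff.continuousOn).enorm.pow_const 2)
  calc _ = ∫⁻ p, liminf (fun m => f m p) atTop ∂discMeasure :=
        lintegral_discMeasure_congr fun p hp => (hlim p hp).liminf_eq.symm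
    _ ≤ liminf (fun m => ∫⁻ p, f m p ∂discMeasure) atTop := lintegral_liminf_le' hmeas
    _ ≤ _ := by
        refine (liminf_le_liminf (Eventually.of_forall hbound)).trans ?_
        rw [liminf_const]

/-- The weight `1 / ((n + 1) (n + 2))`, which is the squared norm of `zⁿ` with respect to
`discMeasure` divided by `π`. -/
noncomputable def weight (n : ℕ) : ℝ := 1 / (((n : ℝ) + 1) * ((n : ℝ) + 2))

lemma weight_pos (n : ℕ) : 0 < weight n := by unfold weight; positivity

lemma weight_mul_sq (n : ℕ) : weight n * ((n : ℝ) + 1) ^ 2 = 1 - 1 / ((n : ℝ) + 2) := by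
  unfold weight; field_simp; ring

lemma summable_weight_of_lintegral_ne_top {c : ℕ → ℂ} (hc : ConvOn c 1)
    (h : ∫⁻ p, ‖powSum c (toC p)‖ₑ ^ 2 ∂discMeasure ≠ ⊤) :
    Summable fun n => weight n * ‖c n‖ ^ 2 := by
  rw [hc.lintegral_disc_sq] at h
  have h1 : ∑' n : ℕ, ENNReal.ofReal (weight n * ‖c n‖ ^ 2) ≠ ⊤ := by
    intro ht
    refine h ?_
    simp_rw [ENNReal.ofReal_mul (weight_pos _).le, ← enorm_sq_eq_ofReal] at ht
    unfold weight at ht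
    rw [ht]
    exact ENNReal.mul_top (by simpa using pi_pos)
  have := ENNReal.summable_toReal h1
  refine this.congr fun n => ?_
  rw [ENNReal.toReal_ofReal (mul_nonneg (weight_pos n).le (sq_nonneg _))]

lemma ConvOn.lintegral_disc_sq_real {c : ℕ → ℂ} (hc : ConvOn c 1)
    (hs : Summable fun n => weight n * ‖c n‖ ^ 2) :
    ∫⁻ p, ‖powSum c (toC p)‖ₑ ^ 2 ∂discMeasure
      = ENNReal.ofReal (π * ∑' n, weight n * ‖c n‖ ^ 2) := by
  rw [hc.lintegral_disc_sq, ENNReal.ofReal_mul pi_pos.le,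
    ENNReal.ofReal_tsum_of_nonneg (fun n => mul_nonneg (weight_pos n).le (sq_nonneg _)) hs]
  simp_rw [ENNReal.ofReal_mul (weight_pos _).le, ← enorm_sq_eq_ofReal]
  rfl

lemma ConvOn.add {c d : ℕ → ℂ} {R : ℝ} (hc : ConvOn c R) (hd : ConvOn d R) :
    ConvOn (fun n => c n + d n) R := by
  intro r h0 hr
  refine ((hc r h0 hr).add (hd r h0 hr)).of_nonneg_of_le (fun _ => by positivity) fun n => ?_
  rw [← mul_add]
  exact mul_le_mul_of_nonneg_left (norm_add_le _ _) (by positivity)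

lemma ConvOn.neg {c : ℕ → ℂ} {R : ℝ} (hc : ConvOn c R) : ConvOn (fun n => -c n) R := by
  simpa [ConvOn] using hc

lemma powSum_add {c d : ℕ → ℂ} (hc : ConvOn c 1) (hd : ConvOn d 1) {z : ℂ} (hz : ‖z‖ < 1) :
    powSum (fun n => c n + d n) z = powSum c z + powSum d z :=
  (((hc.hasSum hz).add (hd.hasSum hz)).congr_terms fun _ => add_mul _ _ _).tsum_eq

lemma powSum_neg (c : ℕ → ℂ) (z : ℂ) : powSum (fun n => -c n) z = -powSum c z := by
  simp [powSum, tsum_neg]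

/-- The pairing of two real power series in the weighted Bergman space is controlled by the
integral of the product of their moduli. -/
lemma pairing_le_lintegral {γ q : ℕ → ℝ} (hγ : ConvOn (fun n => (γ n : ℂ)) 1)
    (hq : ConvOn (fun n => (q n : ℂ)) 1) (hγs : Summable fun n => weight n * γ n ^ 2)
    (hqs : Summable fun n => weight n * q n ^ 2) :
    ENNReal.ofReal (π * ∑' n, weight n * (γ n * q n))
      ≤ ∫⁻ p, ‖powSum (fun n => (γ n : ℂ)) (toC p)‖ₑ * ‖powSum (fun n => (q n : ℂ)) (toC p)‖ₑ
        ∂discMeasure := by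
  set X := ∫⁻ p, ‖powSum (fun n => (γ n : ℂ)) (toC p)‖ₑ * ‖powSum (fun n => (q n : ℂ)) (toC p)‖ₑ
    ∂discMeasure with hX
  rcases eq_or_ne X ⊤ with hT | hT
  · rw [hT]; exact le_top
  have hm : Summable fun n => weight n * (γ n * q n) := by
    refine (hγs.add hqs).of_norm_bounded fun n => ?_
    rw [norm_mul, norm_of_nonneg (weight_pos n).le, ← mul_add]
    refine mul_le_mul_of_nonneg_left ?_ (weight_pos n).le
    rw [Real.norm_eq_abs, abs_le]
    constructor <;> nlinarith [sq_nonneg (γ n + q n), sq_nonneg (γ n - q n)]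
  have hsum : HasSum (fun n => weight n * ‖(γ n : ℂ) + (q n : ℂ)‖ ^ 2)
      (∑' n, weight n * γ n ^ 2 + ∑' n, weight n * q n ^ 2
        + 2 * ∑' n, weight n * (γ n * q n)) := by
    refine ((hγs.hasSum.add hqs.hasSum).add (hm.hasSum.mul_left 2)).congr_terms fun n => ?_
    rw [← Complex.ofReal_add, Complex.norm_real, Real.norm_eq_abs, sq_abs]
    ring
  have hdiff : HasSum (fun n => weight n * ‖(γ n : ℂ) + -(q n : ℂ)‖ ^ 2)
      (∑' n, weight n * γ n ^ 2 + ∑' n, weight n * q n ^ 2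
        - 2 * ∑' n, weight n * (γ n * q n)) := by
    refine ((hγs.hasSum.add hqs.hasSum).sub (hm.hasSum.mul_left 2)).congr_terms fun n => ?_
    rw [← Complex.ofReal_neg, ← Complex.ofReal_add, Complex.norm_real, Real.norm_eq_abs, sq_abs]
    ring
  have key : ENNReal.ofReal (π * ∑' n, weight n * ‖(γ n : ℂ) + (q n : ℂ)‖ ^ 2)
      ≤ ENNReal.ofReal (π * ∑' n, weight n * ‖(γ n : ℂ) + -(q n : ℂ)‖ ^ 2) + 4 * X := by
    rw [← (hγ.add hq).lintegral_disc_sq_real hsum.summable,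
      ← (hγ.add hq.neg).lintegral_disc_sq_real hdiff.summable, hX,
      ← lintegral_const_mul' _ _ (by norm_num), ← lintegral_add_left']
    · refine lintegral_discMeasure_mono fun p hp => ?_
      have hz := norm_toC_lt hp
      rw [powSum_add hγ hq hz, powSum_add hγ hq.neg hz, powSum_neg]
      generalize powSum (fun n => (γ n : ℂ)) (toC p) = u
      generalize powSum (fun n => (q n : ℂ)) (toC p) = v
      rw [enorm_sq_eq_ofReal, enorm_sq_eq_ofReal, ← ofReal_norm, ← ofReal_norm,
        ← ENNReal.ofReal_mul (norm_nonneg _), show (4 : ℝ≥0∞) = ENNReal.ofReal 4 by norm_num,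
        ← ENNReal.ofReal_mul (by norm_num), ← ENNReal.ofReal_add (by positivity) (by positivity)]
      refine ENNReal.ofReal_le_ofReal ?_
      have h1 : ‖u + v‖ ≤ ‖u‖ + ‖v‖ := norm_add_le _ _
      have h2 : |‖u‖ - ‖v‖| ≤ ‖u + -v‖ := by rw [← sub_eq_add_neg]; exact abs_norm_sub_norm_le u v
      have h3 : (‖u‖ - ‖v‖) ^ 2 ≤ ‖u + -v‖ ^ 2 := by rw [← sq_abs]; gcongr
      nlinarith [norm_nonneg (u + v), norm_nonneg u, norm_nonneg v]
    · exact (aemeasurable_discMeasure (hγ.add hq.neg).continuousOn).enorm.pow_const 2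
  rw [hsum.tsum_eq, hdiff.tsum_eq, ← ENNReal.ofReal_toReal hT,
    show (4 : ℝ≥0∞) = ENNReal.ofReal 4 by norm_num, ← ENNReal.ofReal_mul (by norm_num),
    ← ENNReal.ofReal_add (mul_nonneg pi_pos.le (hdiff.tsum_eq ▸
      tsum_nonneg fun n => mul_nonneg (weight_pos n).le (sq_nonneg _))) (by positivity),
    ENNReal.ofReal_le_ofReal_iff (add_nonneg (mul_nonneg pi_pos.le (hdiff.tsum_eq ▸
      tsum_nonneg fun n => mul_nonneg (weight_pos n).le (sq_nonneg _))) (by positivity))] at key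
  rw [← ENNReal.ofReal_toReal hT]
  refine ENNReal.ofReal_le_ofReal ?_
  nlinarith

lemma summable_coeff_mul (g : Polynomial ℝ) (w : ℕ → ℝ) : Summable fun n => w n * g.coeff n :=
  summable_of_hasFiniteSupport (g.support.finite_toSet.subset fun n hn => by
    simp only [Function.mem_support, ne_eq, mul_eq_zero, not_or] at hn
    simpa using hn.2)

lemma summable_coeff_sq (g : Polynomial ℝ) : Summable fun n => g.coeff n ^ 2 := by
  simpa [sq] using summable_coeff_mul g g.coeff

lemma summable_weight_coeff_sq (g : Polynomial ℝ) : Summable fun n => weight n * g.coeff n ^ 2 := by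
  simpa [sq, mul_assoc] using summable_coeff_mul g fun n => weight n * g.coeff n

lemma convOn_coeff (g : Polynomial ℝ) (R : ℝ) : ConvOn (fun n => (g.coeff n : ℂ)) R := by
  intro r h0 _
  refine (summable_coeff_mul g fun n => r ^ n).norm.congr fun n => ?_
  rw [norm_mul, norm_of_nonneg (pow_nonneg h0 n), Complex.norm_real]

lemma powSum_coeff (g : Polynomial ℝ) (z : ℂ) :
    powSum (fun n => (g.coeff n : ℂ)) z = Polynomial.aeval z g := by
  rw [Polynomial.aeval_eq_sum_range, powSum, tsum_eq_sum (s := Finset.range (g.natDegree + 1))]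
  · simp
  · intro n hn
    rw [Polynomial.coeff_eq_zero_of_natDegree_lt (by simpa using hn)]
    simp

lemma powSum_coeff_mul (f g : Polynomial ℝ) (z : ℂ) :
    powSum (fun n => ((f * g).coeff n : ℂ)) z
      = powSum (fun n => (f.coeff n : ℂ)) z * powSum (fun n => (g.coeff n : ℂ)) z := by
  simp [powSum_coeff]

lemma lintegral_derivative_sq_le (f : Polynomial ℝ) :
    ∫⁻ p, ‖powSum (fun n => (f.derivative.coeff n : ℂ)) (toC p)‖ₑ ^ 2 ∂discMeasure
      ≤ ENNReal.ofReal (π * ∑' n, f.coeff n ^ 2) := by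
  have hs : Summable fun n => weight n * ‖(f.derivative.coeff n : ℂ)‖ ^ 2 := by
    simpa using summable_weight_coeff_sq f.derivative
  rw [(convOn_coeff _ 1).lintegral_disc_sq_real hs]
  refine ENNReal.ofReal_le_ofReal (mul_le_mul_of_nonneg_left ?_ pi_pos.le)
  have h1 : ∑' n, f.coeff (n + 1) ^ 2 ≤ ∑' n, f.coeff n ^ 2 := by
    rw [(summable_coeff_sq f).tsum_eq_zero_add]
    exact le_add_of_nonneg_left (sq_nonneg _)
  refine le_trans (hs.tsum_le_tsum (fun n => ?_)
    ((summable_nat_add_iff 1).2 (summable_coeff_sq f))) h1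
  rw [Complex.norm_real, Real.norm_eq_abs, sq_abs, Polynomial.coeff_derivative, mul_pow,
    mul_left_comm, weight_mul_sq]
  refine mul_le_of_le_one_right (sq_nonneg _) ?_
  have : 0 < 1 / ((n : ℝ) + 2) := by positivity
  linarith

lemma abs_coeff_mul_le (f g : Polynomial ℝ) (n : ℕ) :
    |(f * g).coeff n| ≤ √(∑' n, f.coeff n ^ 2) * √(∑' n, g.coeff n ^ 2) := by
  rw [← Real.sqrt_mul (tsum_nonneg fun n => sq_nonneg _), Polynomial.coeff_mul]
  refine Real.abs_le_sqrt ((Finset.sum_mul_sq_le_sq_mul_sq _ _ _).trans ?_)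
  rw [Finset.Nat.sum_antidiagonal_eq_sum_range_succ (fun i _ => f.coeff i ^ 2),
    ← Finset.Nat.sum_antidiagonal_swap]
  simp only [Prod.snd_swap]
  rw [Finset.Nat.sum_antidiagonal_eq_sum_range_succ (fun i _ => g.coeff i ^ 2)]
  exact mul_le_mul ((summable_coeff_sq f).sum_le_tsum _ fun _ _ => sq_nonneg _)
    ((summable_coeff_sq g).sum_le_tsum _ fun _ _ => sq_nonneg _)
    (Finset.sum_nonneg fun _ _ => sq_nonneg _) (tsum_nonneg fun _ => sq_nonneg _)

/-- A Carleson-type estimate tested on real polynomials. -/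
def PolyCarleson (β : ℕ → ℝ) (C : ℝ) : Prop := ∀ g : Polynomial ℝ,
  ∫⁻ p, ‖powSum (fun n => (g.coeff n : ℂ)) (toC p)‖ₑ ^ 2 *
    ‖powSum (derivCoeff fun n => (β n : ℂ)) (toC p)‖ₑ ^ 2 ∂discMeasure
    ≤ ENNReal.ofReal (C * ∑' n, g.coeff n ^ 2)

lemma PolyCarleson.lintegral_mul_le {β : ℕ → ℝ} {C : ℝ} (h : PolyCarleson β C) (hC : 0 ≤ C)
    (hβ : ConvOn (fun n => (β n : ℂ)) 1) (f g : Polynomial ℝ) :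
    ∫⁻ p, ‖powSum (derivCoeff fun n => (β n : ℂ)) (toC p)‖ₑ *
      ‖powSum (fun n => ((f.derivative * g).coeff n : ℂ)) (toC p)‖ₑ ∂discMeasure
      ≤ ENNReal.ofReal (√(C * π) * (√(∑' n, f.coeff n ^ 2) * √(∑' n, g.coeff n ^ 2))) := by
  have hm1 : AEMeasurable (fun p => ‖powSum (derivCoeff fun n => (β n : ℂ)) (toC p)‖ₑ)
    discMeasure := (aemeasurable_discMeasure hβ.derivCoeff.continuousOn).enorm
  have hm2 : ∀ g : Polynomial ℝ, AEMeasurable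
      (fun p => ‖powSum (fun n => (g.coeff n : ℂ)) (toC p)‖ₑ) discMeasure := fun g =>
    (aemeasurable_discMeasure (convOn_coeff g 1).continuousOn).enorm
  have hH := ENNReal.lintegral_mul_le_Lp_mul_Lq discMeasure Real.HolderConjugate.two_two
    ((hm2 g).mul hm1) (hm2 f.derivative)
  have hF : 0 ≤ ∑' n, f.coeff n ^ 2 := tsum_nonneg fun _ => sq_nonneg _
  have hG : 0 ≤ ∑' n, g.coeff n ^ 2 := tsum_nonneg fun _ => sq_nonneg _
  simp only [Pi.mul_apply, ENNReal.rpow_two, mul_pow] at hH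
  calc _ = _ := by
        refine lintegral_congr fun p => ?_
        rw [powSum_coeff_mul, enorm_mul]
        ring
    _ ≤ _ := hH
    _ ≤ ENNReal.ofReal (C * ∑' n, g.coeff n ^ 2) ^ (1 / 2 : ℝ) *
          ENNReal.ofReal (π * ∑' n, f.coeff n ^ 2) ^ (1 / 2 : ℝ) := by
        refine mul_le_mul' (ENNReal.rpow_le_rpow (h g) (by norm_num))
          (ENNReal.rpow_le_rpow (lintegral_derivative_sq_le f) (by norm_num))
    _ = _ := by
        rw [ENNReal.ofReal_rpow_of_nonneg (by positivity) (by norm_num),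
          ENNReal.ofReal_rpow_of_nonneg (by positivity) (by norm_num),
          ← ENNReal.ofReal_mul (by positivity), ← Real.sqrt_eq_rpow, ← Real.sqrt_eq_rpow,
          Real.sqrt_mul hC, Real.sqrt_mul pi_pos.le, Real.sqrt_mul hC]
        congr 1
        ring

lemma PolyCarleson.summable_weight {β : ℕ → ℝ} {C : ℝ} (h : PolyCarleson β C)
    (hβ : ConvOn (fun n => (β n : ℂ)) 1) :
    Summable fun n => weight n * (((n : ℝ) + 1) * β (n + 1)) ^ 2 := by
  have h1 := h 1
  simp only [powSum_coeff, map_one, enorm_one, one_pow, one_mul] at h1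
  refine (summable_weight_of_lintegral_ne_top hβ.derivCoeff
    (h1.trans_lt ENNReal.ofReal_lt_top).ne).congr fun n => ?_
  rw [derivCoeff, norm_mul, Complex.norm_real, mul_pow, mul_pow, Real.norm_eq_abs, sq_abs]
  rw [show ‖(n : ℂ) + 1‖ = n + 1 from mod_cast Complex.norm_natCast (n + 1)]

lemma PolyCarleson.summable_remainder {β : ℕ → ℝ} {C : ℝ} (h : PolyCarleson β C)
    (hβ : ConvOn (fun n => (β n : ℂ)) 1) : Summable fun n => |β (n + 1)| / ((n : ℝ) + 2) := by
  have hsq : Summable fun n : ℕ => 1 / ((n : ℝ) + 2) ^ 2 := by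
    have := (summable_nat_add_iff 2).2 (Real.summable_one_div_nat_pow.2 one_lt_two)
    exact_mod_cast this
  refine (((h.summable_weight hβ).mul_left 2).add hsq).of_nonneg_of_le
    (fun n => by positivity) fun n => ?_
  rw [mul_pow, ← mul_assoc (weight n), weight_mul_sq]
  have hn : 1 / ((n : ℝ) + 2) ≤ 1 / 2 := by
    apply one_div_le_one_div_of_le <;> linarith [(n.cast_nonneg : (0 : ℝ) ≤ n)]
  have h0 : 0 < 1 / ((n : ℝ) + 2) := by positivity
  rw [div_eq_mul_one_div, ← sq_abs (β (n + 1)), ← one_div_pow]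
  have hb := abs_nonneg (β (n + 1))
  generalize |β (n + 1)| = y at *
  generalize 1 / ((n : ℝ) + 2) = t at *
  nlinarith [sq_nonneg (y - t), mul_nonneg (sub_nonneg.2 hn) (sq_nonneg y)]

lemma PolyCarleson.abs_pairing_le {β : ℕ → ℝ} {C : ℝ} (h : PolyCarleson β C) (hC : 0 ≤ C)
    (hβ : ConvOn (fun n => (β n : ℂ)) 1) (f g : Polynomial ℝ) :
    π * |∑' n, weight n * (((n : ℝ) + 1) * β (n + 1) * (f.derivative * g).coeff n)|
      ≤ √(C * π) * (√(∑' n, f.coeff n ^ 2) * √(∑' n, g.coeff n ^ 2)) := by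
  have hd : (derivCoeff fun n => (β n : ℂ)) =
      fun n : ℕ => ((((n : ℝ) + 1) * β (n + 1) : ℝ) : ℂ) := by
    ext n; simp [derivCoeff]
  have one_side : ∀ f : Polynomial ℝ,
      π * ∑' n, weight n * (((n : ℝ) + 1) * β (n + 1) * (f.derivative * g).coeff n)
        ≤ √(C * π) * (√(∑' n, f.coeff n ^ 2) * √(∑' n, g.coeff n ^ 2)) := by
    intro f
    have h1 := h.lintegral_mul_le hC hβ f g
    rw [hd] at h1
    exact (ENNReal.ofReal_le_ofReal_iff (by positivity)).1
      ((pairing_le_lintegral (hd ▸ hβ.derivCoeff) (convOn_coeff _ 1) (h.summable_weight hβ)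
        (summable_weight_coeff_sq _)).trans h1)
  rcases abs_cases (∑' n, weight n * (((n : ℝ) + 1) * β (n + 1) * (f.derivative * g).coeff n))
    with h1 | h1
  · rw [h1.1]; exact one_side f
  · rw [h1.1, ← tsum_neg]
    simpa using one_side (-f)

/-- A Carleson-type estimate on real polynomials makes the Hankel form bounded on them. -/
lemma PolyCarleson.hankel_le {β : ℕ → ℝ} {C : ℝ} (h : PolyCarleson β C) (hC : 0 ≤ C)
    (hβ : ConvOn (fun n => (β n : ℂ)) 1) : ∃ K, 0 ≤ K ∧ ∀ f g : Polynomial ℝ,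
      |∑' n, β n * (f * g).coeff n| ≤ K * (√(∑' n, f.coeff n ^ 2) * √(∑' n, g.coeff n ^ 2)) := by
  have hr := h.summable_remainder hβ
  set R := ∑' n, |β (n + 1)| / ((n : ℝ) + 2) with hR
  have hR0 : 0 ≤ R := tsum_nonneg fun n => by positivity
  refine ⟨|β 0| + (2 * (√(C * π) / π) + R), by positivity, fun f g => ?_⟩
  set M := √(∑' n, f.coeff n ^ 2) * √(∑' n, g.coeff n ^ 2) with hM
  have hM0 : 0 ≤ M := by positivity
  have hp1 := h.abs_pairing_le hC hβ f g
  have hp2 := h.abs_pairing_le hC hβ g f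
  rw [mul_comm √(∑' n, g.coeff n ^ 2)] at hp2
  rw [← hM, mul_comm π, ← le_div_iff₀ pi_pos] at hp1 hp2
  set γ : ℕ → ℝ := fun n => weight n * (((n : ℝ) + 1) * β (n + 1)) with hγ
  have e1 : ∀ u : Polynomial ℝ, (fun n => weight n * (((n : ℝ) + 1) * β (n + 1) * u.coeff n))
      = fun n => γ n * u.coeff n := fun u => by ext n; simp only [hγ]; ring
  simp only [e1] at hp1 hp2
  have hrem : |∑' n, β (n + 1) / ((n : ℝ) + 2) * (f * g).coeff (n + 1)| ≤ R * M := by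
    rw [hR, ← tsum_mul_right]
    rw [← Real.norm_eq_abs]
    refine tsum_of_norm_bounded (hr.mul_right M).hasSum fun n => ?_
    rw [norm_mul, norm_div, Real.norm_eq_abs, Real.norm_eq_abs, Real.norm_eq_abs,
      abs_of_pos (show 0 < (n : ℝ) + 2 by positivity)]
    exact mul_le_mul_of_nonneg_left (abs_coeff_mul_le f g _) (by positivity)
  have hremS : Summable fun n => β (n + 1) / ((n : ℝ) + 2) * (f * g).coeff (n + 1) := by
    have := (summable_nat_add_iff 1).2
      (summable_coeff_mul (f * g) fun n => β n / ((n : ℝ) + 1))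
    refine this.congr fun n => ?_
    push_cast
    ring_nf
  have hsplit : ∑' n, β n * (f * g).coeff n = β 0 * (f * g).coeff 0 +
      (∑' n, γ n * (f.derivative * g).coeff n + ∑' n, γ n * (g.derivative * f).coeff n
        + ∑' n, β (n + 1) / ((n : ℝ) + 2) * (f * g).coeff (n + 1)) := by
    rw [(summable_coeff_mul _ β).tsum_eq_zero_add]
    congr 1
    refine ((((summable_coeff_mul _ γ).hasSum.add (summable_coeff_mul _ γ).hasSum).add
      hremS.hasSum).congr_terms fun n => ?_).tsum_eq
    have hder : (f.derivative * g).coeff n + (g.derivative * f).coeff n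
        = (f * g).coeff (n + 1) * ((n : ℝ) + 1) := by
      rw [← Polynomial.coeff_derivative, Polynomial.derivative_mul, Polynomial.coeff_add,
        mul_comm f]
    rw [← mul_add, hder]
    have hw := weight_mul_sq n
    have : γ n * ((f * g).coeff (n + 1) * ((n : ℝ) + 1))
      = (weight n * ((n : ℝ) + 1) ^ 2) * (β (n + 1) * (f * g).coeff (n + 1)) := by
      simp only [hγ]; ring
    rw [this, hw]
    ring
  rw [hsplit]
  have h0 : |β 0 * (f * g).coeff 0| ≤ |β 0| * M := by
    rw [abs_mul]
    exact mul_le_mul_of_nonneg_left (abs_coeff_mul_le f g 0) (abs_nonneg _)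
  have hdiv : √(C * π) * M / π = √(C * π) / π * M := by ring
  rw [hdiv] at hp1 hp2
  refine (abs_add_le _ _).trans ?_
  refine (add_le_add h0 ((abs_add_le _ _).trans
    (add_le_add ((abs_add_le _ _).trans (add_le_add hp1 hp2)) hrem))).trans (le_of_eq ?_)
  ring

/-- The Hankel form with symbol `β`, as a linear functional of the product polynomial. -/
noncomputable def hankelFunctional (β : ℕ → ℝ) : Polynomial ℝ →ₗ[ℝ] ℝ where
  toFun h := ∑' n, β n * h.coeff n
  map_add' f g := by
    simp_rw [Polynomial.coeff_add, mul_add]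
    exact (summable_coeff_mul f β).tsum_add (summable_coeff_mul g β)
  map_smul' c f := by
    simp_rw [Polynomial.coeff_smul, smul_eq_mul, mul_left_comm _ c, tsum_mul_left]
    rfl

lemma hankelFunctional_apply (β : ℕ → ℝ) (h : Polynomial ℝ) :
    hankelFunctional β h = ∑' n, β n * h.coeff n := rfl

lemma hankelFunctional_monomial (β : ℕ → ℝ) (n : ℕ) (c : ℝ) :
    hankelFunctional β (Polynomial.monomial n c) = β n * c := by
  rw [hankelFunctional_apply, tsum_eq_single n fun m hm => by
    rw [Polynomial.coeff_monomial_of_ne _ hm, mul_zero], Polynomial.coeff_monomial_same]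

/-- Boundedness of the Hankel form with symbol `β` on real polynomials. -/
def PolyHankel (β : ℕ → ℝ) (K : ℝ) : Prop := ∀ f g : Polynomial ℝ,
  |hankelFunctional β (f * g)| ≤ K * (√(∑' n, f.coeff n ^ 2) * √(∑' n, g.coeff n ^ 2))

lemma tsum_sum_monomial_sq (N : ℕ) (x : ℕ → ℝ) :
    ∑' n, (∑ k ∈ Finset.range N, Polynomial.monomial k (x k)).coeff n ^ 2
      = ∑ k ∈ Finset.range N, x k ^ 2 := by
  have hc : ∀ n, (∑ k ∈ Finset.range N, Polynomial.monomial k (x k)).coeff n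
      = if n ∈ Finset.range N then x n else 0 := fun n => by
    simp [Polynomial.coeff_monomial]
  simp_rw [hc]
  rw [tsum_eq_sum (s := Finset.range N) fun n hn => by simp [hn]]
  exact Finset.sum_congr rfl fun n hn => by rw [if_pos hn]

lemma PolyHankel.hankelBound {β : ℕ → ℝ} {K : ℝ} (h : PolyHankel β K) :
    HankelBound β (K ^ 2) := by
  intro J N x
  set s : ℕ → ℝ := fun j => ∑ k ∈ Finset.range N, β (j + k) * x k with hs
  set S := ∑ j ∈ Finset.range J, s j ^ 2 with hS
  have hS0 : 0 ≤ S := Finset.sum_nonneg fun _ _ => sq_nonneg _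
  set X := ∑ k ∈ Finset.range N, x k ^ 2 with hX
  have hX0 : 0 ≤ X := Finset.sum_nonneg fun _ _ => sq_nonneg _
  have h1 := h (∑ k ∈ Finset.range N, Polynomial.monomial k (x k))
    (∑ j ∈ Finset.range J, Polynomial.monomial j (s j))
  rw [tsum_sum_monomial_sq, tsum_sum_monomial_sq, ← hX, ← hS, mul_comm (Finset.sum _ _),
    Finset.sum_mul_sum, map_sum] at h1
  have h2 : ∑ j ∈ Finset.range J, hankelFunctional β (∑ k ∈ Finset.range N,
      Polynomial.monomial j (s j) * Polynomial.monomial k (x k)) = S := by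
    refine Finset.sum_congr rfl fun j _ => ?_
    simp_rw [map_sum, Polynomial.monomial_mul_monomial, hankelFunctional_monomial]
    rw [sq, hs, Finset.mul_sum]
    exact Finset.sum_congr rfl fun k _ => by ring
  rw [h2, abs_of_nonneg hS0] at h1
  rcases hS0.eq_or_lt with h0 | h0
  · rw [← h0]; positivity
  have h3 : √S ≤ K * √X := by
    refine le_of_mul_le_mul_right ?_ (Real.sqrt_pos.2 h0)
    rwa [Real.mul_self_sqrt hS0, mul_assoc]
  calc S = √S ^ 2 := (Real.sq_sqrt hS0).symm
    _ ≤ (K * √X) ^ 2 := by gcongr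
    _ = K ^ 2 * X := by rw [mul_pow, Real.sq_sqrt hX0]

/-- The `i`-th real coordinate of a quaternion. -/
noncomputable def quatCoord (i : Fin 4) : ℍ[ℝ] →L[ℝ] ℝ :=
  (EuclideanSpace.proj i).comp
    (Quaternion.linearIsometryEquivTuple.toContinuousLinearEquiv :
      ℍ[ℝ] →L[ℝ] EuclideanSpace ℝ (Fin 4))

lemma quatCoord_apply (i : Fin 4) (q : ℍ[ℝ]) :
    quatCoord i q = Quaternion.linearIsometryEquivTuple q i := rfl

/-- The `i`-th standard basis quaternion. -/
noncomputable def quatUnit (i : Fin 4) : ℍ[ℝ] :=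
  Quaternion.linearIsometryEquivTuple.symm (EuclideanSpace.single i 1)

lemma norm_quatUnit (i : Fin 4) : ‖quatUnit i‖ = 1 := by
  rw [quatUnit, LinearIsometryEquiv.norm_map]
  simp

lemma sum_quatCoord_sq (q : ℍ[ℝ]) : ∑ i, quatCoord i q ^ 2 = ‖q‖ ^ 2 := by
  rw [← Quaternion.linearIsometryEquivTuple.norm_map q, EuclideanSpace.norm_sq_eq]
  simp [quatCoord_apply, sq_abs, -Quaternion.linearIsometryEquivTuple_apply]

lemma abs_quatCoord_le (i : Fin 4) (q : ℍ[ℝ]) : |quatCoord i q| ≤ ‖q‖ := by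
  refine abs_le_of_sq_le_sq ?_ (norm_nonneg q)
  rw [← sum_quatCoord_sq]
  exact Finset.single_le_sum (f := fun i => quatCoord i q ^ 2) (fun _ _ => sq_nonneg _)
    (Finset.mem_univ i)

lemma sum_smul_quatUnit (w : Fin 4 → ℝ) :
    ∑ i, w i • quatUnit i = Quaternion.linearIsometryEquivTuple.symm (WithLp.toLp 2 w) := by
  simp_rw [quatUnit, ← map_smul, ← map_sum]
  congr 1
  ext j
  simp [Pi.single_apply]

lemma sum_quatCoord_smul (q : ℍ[ℝ]) : ∑ i, quatCoord i q • quatUnit i = q := by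
  rw [sum_smul_quatUnit, LinearIsometryEquiv.symm_apply_eq]
  rfl

lemma norm_sum_smul_quatUnit_sq (w : Fin 4 → ℝ) : ‖∑ i, w i • quatUnit i‖ ^ 2 = ∑ i, w i ^ 2 := by
  rw [sum_smul_quatUnit, LinearIsometryEquiv.norm_map, EuclideanSpace.norm_sq_eq]
  simp

lemma convOn_quatCoord {b : ℕ → ℍ[ℝ]}
    (hb : ∀ r : ℝ, 0 ≤ r → r < 1 → Summable fun n => r ^ n * ‖b n‖) (i : Fin 4) :
    ConvOn (fun n => (quatCoord i (b n) : ℂ)) 1 := by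
  intro r h0 hr
  refine (hb r h0 hr).of_nonneg_of_le (fun n => by positivity) fun n => ?_
  rw [Complex.norm_real]
  exact mul_le_mul_of_nonneg_left (abs_quatCoord_le i _) (by positivity)

@[simp] lemma re_iQ (v : EuclideanSpace ℝ (Fin 3)) : (iQ v).re = 0 := rfl

@[simp] lemma imI_iQ (v : EuclideanSpace ℝ (Fin 3)) : (iQ v).imI = v 0 := rfl

@[simp] lemma imJ_iQ (v : EuclideanSpace ℝ (Fin 3)) : (iQ v).imJ = v 1 := rfl

@[simp] lemma imK_iQ (v : EuclideanSpace ℝ (Fin 3)) : (iQ v).imK = v 2 := rfl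

lemma sum_coord_sq (I : Metric.sphere (0 : EuclideanSpace ℝ (Fin 3)) 1) :
    I.1 0 ^ 2 + I.1 1 ^ 2 + I.1 2 ^ 2 = 1 := by
  have h : ‖I.1‖ = 1 := by simp
  have := EuclideanSpace.norm_sq_eq I.1
  rw [h, Fin.sum_univ_three] at this
  simpa using this.symm

lemma iQ_mul_self (I : Metric.sphere (0 : EuclideanSpace ℝ (Fin 3)) 1) : iQ I * iQ I = -1 := by
  have := sum_coord_sq I
  ext <;> simp <;> linarith

lemma norm_iQ (I : Metric.sphere (0 : EuclideanSpace ℝ (Fin 3)) 1) : ‖iQ I‖ = 1 := by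
  have : ‖iQ I‖ * ‖iQ I‖ = 1 := by rw [← norm_mul, iQ_mul_self]; simp
  nlinarith [norm_nonneg (iQ I)]

/-- The embedding of the complex plane onto the slice of `ℍ` spanned by `1` and `iQ I`. -/
noncomputable def sliceEmb (I : Metric.sphere (0 : EuclideanSpace ℝ (Fin 3)) 1) : ℂ →ₐ[ℝ] ℍ[ℝ] :=
  Complex.liftAux (iQ I) (iQ_mul_self I)

section Slice

variable (I : Metric.sphere (0 : EuclideanSpace ℝ (Fin 3)) 1)

lemma sliceEmb_apply (z : ℂ) : sliceEmb I z = (z.re : ℍ[ℝ]) + z.im • iQ I := rfl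

lemma sliceEmb_toC (p : ℝ × ℝ) : sliceEmb I (toC p) = (p.1 : ℍ[ℝ]) + p.2 • iQ I := by
  simp [sliceEmb_apply, toC]

lemma norm_sliceEmb (z : ℂ) : ‖sliceEmb I z‖ = ‖z‖ := by
  have h := sum_coord_sq I
  rw [← sq_eq_sq₀ (norm_nonneg _) (norm_nonneg _), sq ‖_‖, ← Quaternion.normSq_eq_norm_mul_self,
    ← Complex.normSq_eq_norm_sq, Quaternion.normSq_def', Complex.normSq_apply, sliceEmb_apply]
  simp
  linear_combination z.im ^ 2 * h

lemma continuous_sliceEmb : Continuous (sliceEmb I) :=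
  (sliceEmb I).toLinearMap.continuous_of_finiteDimensional

/-- The quaternion on the slice of `I` with complex components `w`. -/
noncomputable def sliceSum (w : Fin 4 → ℂ) : ℍ[ℝ] := ∑ i, sliceEmb I (w i) * quatUnit i

lemma norm_sliceSum_sq_le (w : Fin 4 → ℂ) : ‖sliceSum I w‖ ^ 2 ≤ 4 * ∑ i, ‖w i‖ ^ 2 := by
  have h : ‖sliceSum I w‖ ≤ ∑ i, ‖w i‖ := (norm_sum_le _ _).trans
    (Finset.sum_le_sum fun i _ => by rw [norm_mul, norm_quatUnit, mul_one, norm_sliceEmb])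
  calc ‖sliceSum I w‖ ^ 2 ≤ (∑ i, ‖w i‖) ^ 2 := by gcongr
    _ ≤ 4 * ∑ i, ‖w i‖ ^ 2 := by
      simpa using sq_sum_le_card_mul_sum_sq (s := Finset.univ) (f := fun i : Fin 4 => ‖w i‖)

lemma sliceSum_eq (w : Fin 4 → ℂ) : sliceSum I w
    = ∑ i, (w i).re • quatUnit i + iQ I * ∑ i, (w i).im • quatUnit i := by
  rw [Finset.mul_sum, ← Finset.sum_add_distrib]
  refine Finset.sum_congr rfl fun i _ => ?_
  rw [sliceEmb_apply, add_mul, Quaternion.coe_mul_eq_smul, smul_mul_assoc, mul_smul_comm]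

lemma norm_sliceSum_sq_add_conj (w : Fin 4 → ℂ) :
    ‖sliceSum I w‖ ^ 2 + ‖sliceSum I fun i => (starRingEnd ℂ) (w i)‖ ^ 2
      = 2 * ∑ i, ‖w i‖ ^ 2 := by
  rw [sliceSum_eq, sliceSum_eq]
  simp only [Complex.conj_re, Complex.conj_im, neg_smul, Finset.sum_neg_distrib, mul_neg,
    ← sub_eq_add_neg]
  have := parallelogram_law_with_norm ℝ (∑ i, (w i).re • quatUnit i)
    (iQ I * ∑ i, (w i).im • quatUnit i)
  rw [this, norm_mul, norm_iQ, one_mul, norm_sum_smul_quatUnit_sq, norm_sum_smul_quatUnit_sq,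
    ← Finset.sum_add_distrib]
  congr 1
  refine Finset.sum_congr rfl fun i _ => ?_
  rw [← Complex.normSq_eq_norm_sq, Complex.normSq_apply]
  ring

lemma hasSum_pow_mul {c : ℕ → ℍ[ℝ]} (hc : ∀ i, ConvOn (fun n => (quatCoord i (c n) : ℂ)) 1)
    {z : ℂ} (hz : ‖z‖ < 1) : HasSum (fun n => sliceEmb I z ^ n * c n)
      (sliceSum I fun i => powSum (fun n => (quatCoord i (c n) : ℂ)) z) := by
  have h : ∀ i ∈ Finset.univ, HasSum
      (fun n => sliceEmb I ((quatCoord i (c n) : ℂ) * z ^ n) * quatUnit i)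
      (sliceEmb I (powSum (fun n => (quatCoord i (c n) : ℂ)) z) * quatUnit i) := fun i _ =>
    (((hc i).hasSum hz).map (sliceEmb I) (continuous_sliceEmb I)).mul_right _
  refine (hasSum_sum h).congr_terms fun n => ?_
  conv_lhs => rw [← sum_quatCoord_smul (c n), Finset.mul_sum]
  refine Finset.sum_congr rfl fun i _ => ?_
  rw [map_mul, map_pow, ← Complex.coe_algebraMap, AlgHom.commutes, ← Algebra.smul_def,
    smul_mul_assoc, mul_smul_comm]

lemma cullenDeriv_sliceEmb {b : ℕ → ℍ[ℝ]} (hb : ∀ i, ConvOn (fun n => (quatCoord i (b n) : ℂ)) 1)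
    {z : ℂ} (hz : ‖z‖ < 1) : cullenDeriv b (sliceEmb I z)
      = sliceSum I fun i => powSum (derivCoeff fun n => (quatCoord i (b n) : ℂ)) z := by
  have e : ∀ i, (fun n : ℕ => (quatCoord i (((n + 1 : ℕ) : ℝ) • b (n + 1)) : ℂ))
      = derivCoeff fun n => (quatCoord i (b n) : ℂ) := fun i => by
    ext n
    simp [derivCoeff]
  have h : HasSum (fun n : ℕ => sliceEmb I z ^ n * (((n + 1 : ℕ) : ℝ) • b (n + 1)))
      (sliceSum I fun i => powSum (derivCoeff fun n => (quatCoord i (b n) : ℂ)) z) := by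
    simp_rw [← e]
    exact hasSum_pow_mul I (fun i => by rw [e]; exact (hb i).derivCoeff) hz
  rw [← h.tsum_eq, cullenDeriv]
  exact tsum_congr fun n => (mul_smul_comm _ _ _).symm

lemma powSum_conj {c : ℕ → ℂ} (hc : ∀ n, (starRingEnd ℂ) (c n) = c n) (z : ℂ) :
    powSum c ((starRingEnd ℂ) z) = (starRingEnd ℂ) (powSum c z) := by
  rw [powSum, powSum, Complex.conj_tsum]
  simp [hc]

end Slice

/-- The contribution of the slice of `I` to the Carleson integral. -/
noncomputable def sliceIntegral (b a : ℕ → ℍ[ℝ])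
    (I : Metric.sphere (0 : EuclideanSpace ℝ (Fin 3)) 1) : ℝ≥0∞ :=
  ∫⁻ p, ‖∑' n, sliceEmb I (toC p) ^ n * a n‖ₑ ^ 2 * ‖cullenDeriv b (sliceEmb I (toC p))‖ₑ ^ 2
    ∂discMeasure

lemma lintegral_unitDisc_eq_sliceIntegral (b a : ℕ → ℍ[ℝ])
    (I : Metric.sphere (0 : EuclideanSpace ℝ (Fin 3)) 1) :
    ∫⁻ p in {p : ℝ × ℝ | p.1 ^ 2 + p.2 ^ 2 < 1},
      (‖∑' n : ℕ, ((p.1 : ℍ[ℝ]) + p.2 • iQ (I : EuclideanSpace ℝ (Fin 3))) ^ n * a n‖₊ : ℝ≥0∞) ^ 2 *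
      (‖cullenDeriv b ((p.1 : ℍ[ℝ]) + p.2 • iQ (I : EuclideanSpace ℝ (Fin 3)))‖₊ : ℝ≥0∞) ^ 2 *
      ENNReal.ofReal (1 - p.1 ^ 2 - p.2 ^ 2) ∂(volume : Measure (ℝ × ℝ)) = sliceIntegral b a I := by
  rw [sliceIntegral, lintegral_discMeasure]
  simp_rw [sliceEmb_toC]
  rfl

variable (I : Metric.sphere (0 : EuclideanSpace ℝ (Fin 3)) 1)

lemma enorm_sliceSum_sq_le (w : Fin 4 → ℂ) :
    ‖sliceSum I w‖ₑ ^ 2 ≤ 4 * ∑ i, ‖w i‖ₑ ^ 2 := by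
  simp_rw [enorm_sq_eq_ofReal]
  rw [← ENNReal.ofReal_sum_of_nonneg fun _ _ => sq_nonneg _,
    show (4 : ℝ≥0∞) = ENNReal.ofReal 4 by norm_num, ← ENNReal.ofReal_mul (by norm_num)]
  exact ENNReal.ofReal_le_ofReal (norm_sliceSum_sq_le I w)

lemma aemeasurable_enorm_powSum_sq {c : ℕ → ℂ} (hc : ConvOn c 1) :
    AEMeasurable (fun p => ‖powSum c (toC p)‖ₑ ^ 2) discMeasure :=
  (aemeasurable_discMeasure hc.continuousOn).enorm.pow_const 2

lemma sliceIntegral_le {b a : ℕ → ℍ[ℝ]} {C : ℝ} (hC : 0 ≤ C)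
    (hb : ∀ i, ConvOn (fun n => (quatCoord i (b n) : ℂ)) 1)
    (h : ∀ i, HankelBound (fun n => quatCoord i (b n)) C) (ha : Summable fun n => ‖a n‖ ^ 2) :
    sliceIntegral b a I ≤ ENNReal.ofReal (256 * (rexp C * π) * ∑' n, ‖a n‖ ^ 2) := by
  have hle : ∀ i n, ‖(quatCoord i (a n) : ℂ)‖ ^ 2 ≤ ‖a n‖ ^ 2 := fun i n => by
    rw [Complex.norm_real]
    exact pow_le_pow_left₀ (norm_nonneg _) (abs_quatCoord_le i _) 2
  have has : ∀ i, Summable fun n => ‖(quatCoord i (a n) : ℂ)‖ ^ 2 := fun i =>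
    ha.of_nonneg_of_le (fun _ => sq_nonneg _) (hle i)
  have hac := fun i => convOn_of_summable_sq (has i)
  have hA : ∀ i, ∑' n, ‖(quatCoord i (a n) : ℂ)‖ₑ ^ 2 ≤ ENNReal.ofReal (∑' n, ‖a n‖ ^ 2) := by
    intro i
    rw [ENNReal.ofReal_tsum_of_nonneg (fun _ => sq_nonneg _) ha]
    refine ENNReal.tsum_le_tsum fun n => ?_
    rw [enorm_sq_eq_ofReal]
    exact ENNReal.ofReal_le_ofReal (hle i n)
  have hm : ∀ i j, AEMeasurable (fun p => ‖powSum (fun n => (quatCoord i (a n) : ℂ)) (toC p)‖ₑ ^ 2 *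
      ‖powSum (derivCoeff fun n => (quatCoord j (b n) : ℂ)) (toC p)‖ₑ ^ 2) discMeasure :=
    fun i j => (aemeasurable_enorm_powSum_sq (hac i)).mul
      (aemeasurable_enorm_powSum_sq (hb j).derivCoeff)
  calc sliceIntegral b a I
      ≤ ∫⁻ p, 16 * ∑ i, ∑ j, ‖powSum (fun n => (quatCoord i (a n) : ℂ)) (toC p)‖ₑ ^ 2 *
          ‖powSum (derivCoeff fun n => (quatCoord j (b n) : ℂ)) (toC p)‖ₑ ^ 2 ∂discMeasure := by
        refine lintegral_discMeasure_mono fun p hp => ?_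
        have hz := norm_toC_lt hp
        rw [(hasSum_pow_mul I hac hz).tsum_eq, cullenDeriv_sliceEmb I hb hz]
        refine (mul_le_mul' (enorm_sliceSum_sq_le I _) (enorm_sliceSum_sq_le I _)).trans
          (le_of_eq ?_)
        rw [← Finset.sum_mul_sum]
        ring
    _ = 16 * ∑ i, ∑ j, ∫⁻ p, ‖powSum (fun n => (quatCoord i (a n) : ℂ)) (toC p)‖ₑ ^ 2 *
          ‖powSum (derivCoeff fun n => (quatCoord j (b n) : ℂ)) (toC p)‖ₑ ^ 2 ∂discMeasure := by
        rw [lintegral_const_mul' _ _ (by norm_num), lintegral_finsetSum' _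
          fun i _ => Finset.aemeasurable_fun_sum _ fun j _ => hm i j]
        congr 1
        exact Finset.sum_congr rfl fun i _ => lintegral_finsetSum' _ fun j _ => hm i j
    _ ≤ 16 * ∑ i : Fin 4, ∑ j : Fin 4, ENNReal.ofReal (rexp C * π * ∑' n, ‖a n‖ ^ 2) := by
        refine mul_le_mul' le_rfl (Finset.sum_le_sum fun i _ => Finset.sum_le_sum fun j _ => ?_)
        rw [ENNReal.ofReal_mul (by positivity)]
        exact (carleson_of_hankelBound (h j) hC (hb j) (has i)).trans (mul_le_mul' le_rfl (hA i))
    _ = ENNReal.ofReal (256 * (rexp C * π) * ∑' n, ‖a n‖ ^ 2) := by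
        rw [mul_assoc 256, ENNReal.ofReal_mul (p := 256) (by norm_num)]
        simp only [Finset.sum_const, Finset.card_univ, Fintype.card_fin, nsmul_eq_mul]
        rw [← mul_assoc, ← mul_assoc]
        norm_num

lemma lintegral_discMeasure_reflect (f : ℝ × ℝ → ℝ≥0∞) :
    ∫⁻ p, f (p.1, -p.2) ∂discMeasure = ∫⁻ p, f p ∂discMeasure := by
  have hmp : MeasurePreserving (fun p : ℝ × ℝ => (p.1, -p.2)) volume volume :=
    (MeasurePreserving.id volume).prod (Measure.measurePreserving_neg volume)
  have hemb : MeasurableEmbedding (fun p : ℝ × ℝ => (p.1, -p.2)) :=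
    ((MeasurableEquiv.refl ℝ).prodCongr (MeasurableEquiv.neg ℝ)).measurableEmbedding
  rw [lintegral_discMeasure, lintegral_discMeasure,
    ← hmp.setLIntegral_comp_preimage_emb hemb _ unitDisc]
  simp [unitDisc]

lemma toC_reflect (p : ℝ × ℝ) : toC (p.1, -p.2) = (starRingEnd ℂ) (toC p) := by
  simp [toC]

lemma le_sliceIntegral {b : ℕ → ℍ[ℝ]} (hb : ∀ i, ConvOn (fun n => (quatCoord i (b n) : ℂ)) 1)
    (g : Polynomial ℝ) (j : Fin 4) :
    ∫⁻ p, ‖powSum (fun n => (g.coeff n : ℂ)) (toC p)‖ₑ ^ 2 *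
      ‖powSum (derivCoeff fun n => (quatCoord j (b n) : ℂ)) (toC p)‖ₑ ^ 2 ∂discMeasure
      ≤ sliceIntegral b (fun n => (g.coeff n : ℍ[ℝ])) I := by
  have hg := convOn_coeff g 1
  set B : ℂ → Fin 4 → ℂ := fun z i => powSum (derivCoeff fun n => (quatCoord i (b n) : ℂ)) z with hB
  set G : ℝ × ℝ → ℝ≥0∞ := fun p => ‖powSum (fun n => (g.coeff n : ℂ)) (toC p)‖ₑ ^ 2 *
    ‖sliceSum I (B (toC p))‖ₑ ^ 2 with hG
  have hslice : sliceIntegral b (fun n => (g.coeff n : ℍ[ℝ])) I = ∫⁻ p, G p ∂discMeasure := by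
    refine lintegral_discMeasure_congr fun p hp => ?_
    have hz := norm_toC_lt hp
    have hsum : HasSum (fun n => sliceEmb I (toC p) ^ n * (g.coeff n : ℍ[ℝ]))
        (sliceEmb I (powSum (fun n => (g.coeff n : ℂ)) (toC p))) := by
      refine ((hg.hasSum hz).map (sliceEmb I) (continuous_sliceEmb I)).congr_terms fun n => ?_
      rw [Function.comp_apply, map_mul, map_pow, ← Complex.coe_algebraMap, AlgHom.commutes,
        Quaternion.mul_coe_eq_smul, Algebra.smul_def]
    rw [hsum.tsum_eq, cullenDeriv_sliceEmb I hb hz, hG, ← ofReal_norm, norm_sliceEmb, ofReal_norm]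
  have hGm : AEMeasurable G discMeasure := by
    have : ContinuousOn (fun z => sliceSum I (B z)) (Metric.ball 0 1) :=
      continuousOn_finsetSum _ fun i _ =>
        ((continuous_sliceEmb I).comp_continuousOn (hb i).derivCoeff.continuousOn).mul
          continuousOn_const
    exact (aemeasurable_enorm_powSum_sq hg).mul ((aemeasurable_discMeasure this.enorm).pow_const 2)
  have hpt : ∀ p, 2 * (‖powSum (fun n => (g.coeff n : ℂ)) (toC p)‖ₑ ^ 2 * ‖B (toC p) j‖ₑ ^ 2)
      ≤ G p + G (p.1, -p.2) := by
    intro p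
    have h1 : B (toC (p.1, -p.2)) = fun i => (starRingEnd ℂ) (B (toC p) i) := by
      ext1 i
      rw [toC_reflect, hB]
      exact powSum_conj (fun n => by simp [derivCoeff]) _
    have h2 : powSum (fun n => (g.coeff n : ℂ)) (toC (p.1, -p.2))
        = (starRingEnd ℂ) (powSum (fun n => (g.coeff n : ℂ)) (toC p)) := by
      rw [toC_reflect]
      exact powSum_conj (fun n => Complex.conj_ofReal _) _
    simp only [hG]
    rw [h1, h2, ← ofReal_norm ((starRingEnd ℂ) _), Complex.norm_conj, ofReal_norm, ← mul_add,
      mul_left_comm]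
    refine mul_le_mul' le_rfl ?_
    simp_rw [enorm_sq_eq_ofReal]
    rw [← ENNReal.ofReal_add (by positivity) (by positivity), norm_sliceSum_sq_add_conj,
      show (2 : ℝ≥0∞) = ENNReal.ofReal 2 by norm_num, ← ENNReal.ofReal_mul (by norm_num)]
    refine ENNReal.ofReal_le_ofReal (mul_le_mul_of_nonneg_left ?_ (by norm_num))
    exact Finset.single_le_sum (f := fun i => ‖B (toC p) i‖ ^ 2) (fun _ _ => sq_nonneg _)
      (Finset.mem_univ j)
  have htwo := lintegral_mono (μ := discMeasure) hpt
  rw [lintegral_const_mul' _ _ (by norm_num), lintegral_add_left' hGm,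
    lintegral_discMeasure_reflect, ← two_mul] at htwo
  rw [hslice]
  exact (ENNReal.mul_le_mul_iff_right (by norm_num) (by norm_num)).1 htwo

lemma polyCarleson_of_carleson {b : ℕ → ℍ[ℝ]} {C : ℝ}
    (hb : ∀ i, ConvOn (fun n => (quatCoord i (b n) : ℂ)) 1)
    (h : ∀ a : ℕ → ℍ[ℝ], Summable (fun n => ‖a n‖ ^ 2) →
      ENNReal.ofReal (1 / 4) *
        ∫⁻ I, sliceIntegral b a I ∂(volume : Measure (EuclideanSpace ℝ (Fin 3))).toSphere
        ≤ ENNReal.ofReal (C * ∑' n, ‖a n‖ ^ 2)) (j : Fin 4) :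
    PolyCarleson (fun n => quatCoord j (b n))
      (C / (1 / 4 * ((volume : Measure (EuclideanSpace ℝ (Fin 3))).toSphere.real univ))) := by
  intro g
  set σ := (volume : Measure (EuclideanSpace ℝ (Fin 3))).toSphere with hσ
  have hσ0 : 0 < σ.real univ := by
    rw [measureReal_def]
    exact ENNReal.toReal_pos (by
      rw [Ne, Measure.measure_univ_eq_zero]; exact Measure.toSphere_ne_zero _)
      (measure_ne_top _ _)
  have hnorm : ∀ n, ‖(g.coeff n : ℍ[ℝ])‖ ^ 2 = g.coeff n ^ 2 := fun n => by simp
  have h1 := h (fun n => (g.coeff n : ℍ[ℝ])) (by simpa only [hnorm] using summable_coeff_sq g)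
  simp only [hnorm] at h1
  have h2 := (mul_le_mul' (le_refl (ENNReal.ofReal (1 / 4)))
    (lintegral_mono (μ := σ) fun I => le_sliceIntegral I hb g j)).trans h1
  rw [lintegral_const, ← ofReal_measureReal, mul_left_comm,
    ← ENNReal.ofReal_mul (by norm_num)] at h2
  have h3 : 0 < 1 / 4 * σ.real univ := by positivity
  rw [← ENNReal.le_div_iff_mul_le (Or.inl (ENNReal.ofReal_pos.2 h3).ne')
      (Or.inl ENNReal.ofReal_ne_top),
    ← ENNReal.ofReal_div_of_pos h3] at h2
  rwa [div_mul_eq_mul_div]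

lemma coeff_mul_eq_sum_range (f g : Polynomial ℝ) (n : ℕ) :
    (f * g).coeff n = ∑ k ∈ Finset.range (n + 1), f.coeff k * g.coeff (n - k) := by
  rw [Polynomial.coeff_mul,
    Finset.Nat.sum_antidiagonal_eq_sum_range_succ fun i j => f.coeff i * g.coeff j]

lemma exists_polynomial_coeff {a : ℕ → ℝ} (ha : (Function.support a).Finite) :
    ∃ f : Polynomial ℝ, ∀ n, f.coeff n = a n := by
  refine ⟨∑ k ∈ ha.toFinset, Polynomial.monomial k (a k), fun n => ?_⟩
  simp only [Polynomial.finsetSum_coeff, Polynomial.coeff_monomial, Finset.sum_ite_eq']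
  split_ifs with h
  · rfl
  · simpa [eq_comm] using h

/-- Boundedness of the quaternionic Hankel form passes to the coordinates of its symbol. -/
lemma polyHankel_of_bounded {b : ℕ → ℍ[ℝ]} {C : ℝ}
    (h : ∀ a c : ℕ → ℍ[ℝ], (Function.support a).Finite → (Function.support c).Finite →
      ‖∑' n : ℕ, star (b n) * ∑ k ∈ Finset.range (n + 1), a k * c (n - k)‖
        ≤ C * (∑' n : ℕ, ‖a n‖ ^ 2) ^ (1 / 2 : ℝ) * (∑' n : ℕ, ‖c n‖ ^ 2) ^ (1 / 2 : ℝ))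
    (i : Fin 4) : PolyHankel (fun n => quatCoord i (b n)) C := by
  intro f g
  have hfin : ∀ f : Polynomial ℝ, (Function.support fun n => (f.coeff n : ℍ[ℝ])).Finite := fun f =>
    f.support.finite_toSet.subset fun n hn => by
      rw [Finset.mem_coe, Polynomial.mem_support_iff]
      exact fun h0 => hn (by simp [h0])
  have h1 := h (fun n => (f.coeff n : ℍ[ℝ])) (fun n => (g.coeff n : ℍ[ℝ])) (hfin f) (hfin g)
  have hnorm : ∀ (f : Polynomial ℝ) n, ‖(f.coeff n : ℍ[ℝ])‖ ^ 2 = f.coeff n ^ 2 :=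
    fun f n => by simp
  simp only [hnorm, ← Real.sqrt_eq_rpow] at h1
  have hterm : ∀ n, star (b n) * ∑ k ∈ Finset.range (n + 1),
      (f.coeff k : ℍ[ℝ]) * (g.coeff (n - k) : ℍ[ℝ]) = star ((f * g).coeff n • b n) := fun n => by
    rw [Quaternion.star_smul, ← Quaternion.mul_coe_eq_smul, coeff_mul_eq_sum_range]
    simp_rw [← Quaternion.coe_mul]
    exact congrArg (star (b n) * ·) (map_sum (algebraMap ℝ ℍ[ℝ]) _ _).symm
  simp only [hterm] at h1
  rw [← tsum_star, norm_star] at h1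
  have hs : Summable fun n => (f * g).coeff n • b n :=
    summable_of_hasFiniteSupport ((f * g).support.finite_toSet.subset fun n hn => by
      simp only [Function.mem_support, ne_eq, smul_eq_zero, not_or] at hn
      simpa using hn.1)
  have hc : hankelFunctional (fun n => quatCoord i (b n)) (f * g)
      = quatCoord i (∑' n, (f * g).coeff n • b n) := by
    rw [(quatCoord i).map_tsum hs, hankelFunctional_apply]
    exact tsum_congr fun n => by rw [map_smul, smul_eq_mul, mul_comm]
  rw [hc, ← mul_assoc]
  exact (abs_quatCoord_le i _).trans h1

/-- Boundedness of the Hankel forms of all coordinates gives boundedness of the quaternionic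
Hankel form. -/
lemma bounded_of_polyHankel {b : ℕ → ℍ[ℝ]} {K : Fin 4 → ℝ} (hK : ∀ i, 0 ≤ K i)
    (h : ∀ i, PolyHankel (fun n => quatCoord i (b n)) (K i)) {a c : ℕ → ℍ[ℝ]}
    (ha : (Function.support a).Finite) (hc : (Function.support c).Finite) :
    ‖∑' n : ℕ, star (b n) * ∑ k ∈ Finset.range (n + 1), a k * c (n - k)‖
      ≤ (∑ i : Fin 4, ∑ _p : Fin 4, ∑ _q : Fin 4, K i) * √(∑' n, ‖a n‖ ^ 2) *
        √(∑' n, ‖c n‖ ^ 2) := by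
  have hex : ∀ {a : ℕ → ℍ[ℝ]}, (Function.support a).Finite → ∀ i, ∃ f : Polynomial ℝ,
      ∀ n, f.coeff n = quatCoord i (a n) := fun ha i =>
    exists_polynomial_coeff (ha.subset fun n hn hn0 => hn (by simp only [hn0, map_zero]))
  have hle : ∀ {a : ℕ → ℍ[ℝ]} (_ : (Function.support a).Finite) (i : Fin 4) (f : Polynomial ℝ),
      (∀ n, f.coeff n = quatCoord i (a n)) → √(∑' n, f.coeff n ^ 2) ≤ √(∑' n, ‖a n‖ ^ 2) := by
    intro a ha i f hf
    refine Real.sqrt_le_sqrt ((summable_coeff_sq f).tsum_le_tsum (fun n => ?_) ?_)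
    · rw [hf, ← sq_abs]
      exact pow_le_pow_left₀ (abs_nonneg _) (abs_quatCoord_le i _) 2
    · exact summable_of_hasFiniteSupport (ha.subset fun n hn hn0 => hn (by simp [hn0]))
  choose f hf using hex ha
  choose g hg using hex hc
  have hconv : ∀ n, ∑ k ∈ Finset.range (n + 1), a k * c (n - k)
      = ∑ p, ∑ q, (f p * g q).coeff n • (quatUnit p * quatUnit q) := by
    intro n
    simp_rw [coeff_mul_eq_sum_range, Finset.sum_smul]
    rw [Finset.sum_congr rfl fun p _ => Finset.sum_comm, Finset.sum_comm]
    refine Finset.sum_congr rfl fun k _ => ?_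
    conv_lhs => rw [← sum_quatCoord_smul (a k), ← sum_quatCoord_smul (c (n - k)),
      Finset.sum_mul_sum]
    refine Finset.sum_congr rfl fun p _ => Finset.sum_congr rfl fun q _ => ?_
    rw [hf, hg, smul_mul_smul_comm]
  have hterm : ∀ n, star (b n) * ∑ k ∈ Finset.range (n + 1), a k * c (n - k)
      = ∑ i, ∑ p, ∑ q, (quatCoord i (b n) * (f p * g q).coeff n) •
        (star (quatUnit i) * (quatUnit p * quatUnit q)) := by
    intro n
    rw [hconv]
    conv_lhs => rw [← sum_quatCoord_smul (b n), star_sum, Finset.sum_mul]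
    refine Finset.sum_congr rfl fun i _ => ?_
    rw [Finset.mul_sum]
    refine Finset.sum_congr rfl fun p _ => ?_
    rw [Finset.mul_sum]
    refine Finset.sum_congr rfl fun q _ => ?_
    rw [Quaternion.star_smul, smul_mul_smul_comm]
  have hsum : HasSum (fun n => star (b n) * ∑ k ∈ Finset.range (n + 1), a k * c (n - k))
      (∑ i, ∑ p, ∑ q, hankelFunctional (fun n => quatCoord i (b n)) (f p * g q) •
        (star (quatUnit i) * (quatUnit p * quatUnit q))) :=
    (hasSum_sum fun i _ => hasSum_sum fun p _ => hasSum_sum fun q _ =>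
      (summable_coeff_mul (f p * g q) fun n => quatCoord i (b n)).hasSum.smul_const
        (star (quatUnit i) * (quatUnit p * quatUnit q))).congr_terms hterm
  rw [hsum.tsum_eq, mul_assoc]
  simp_rw [Finset.sum_mul]
  refine (norm_sum_le _ _).trans (Finset.sum_le_sum fun i _ => ?_)
  refine (norm_sum_le _ _).trans (Finset.sum_le_sum fun p _ => ?_)
  refine (norm_sum_le _ _).trans (Finset.sum_le_sum fun q _ => ?_)
  rw [norm_smul, norm_mul, norm_mul, norm_star, norm_quatUnit, norm_quatUnit, norm_quatUnit,
    mul_one, mul_one, mul_one, Real.norm_eq_abs]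
  refine (h i (f p) (g q)).trans (mul_le_mul_of_nonneg_left ?_ (hK i))
  exact mul_le_mul (hle ha p _ (hf p)) (hle hc q _ (hg q)) (Real.sqrt_nonneg _)
    (Real.sqrt_nonneg _)

end SliceHankel

/-- **Quaternionic Nehari theorem.**
Let `b(q) = ∑ₙ qⁿ b̌(n)` be regular on `𝔹` (the power series converges on `𝔹`). The
Hankel bilinear form `T_b(f,g) = ⟨f⋆g, b⟩_{H²(𝔹)}` is bounded if and only if the measure
`dμ_b(q) = |∂_c b(q)|²(1 − |q|²) dVol_𝔹(q)` is a Carleson measure for `H²(𝔹)`, where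
`dVol_𝔹(x+yI) = (1/4) dA_𝕊(I) dx dy` in slice coordinates (`dA_𝕊` the surface area
measure on the 2-sphere of imaginary units, realized as the unit sphere of `ℝ³`). -/
theorem hankel_bounded_iff_carleson (b : ℕ → ℍ[ℝ])
    (hb : ∀ r : ℝ, 0 ≤ r → r < 1 → Summable fun n => r ^ n * ‖b n‖) :
    (∃ C₁ : ℝ, 0 ≤ C₁ ∧ ∀ a c : ℕ → ℍ[ℝ],
      (Function.support a).Finite → (Function.support c).Finite →
      ‖∑' n : ℕ, star (b n) * ∑ k ∈ Finset.range (n + 1), a k * c (n - k)‖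
        ≤ C₁ * (∑' n : ℕ, ‖a n‖ ^ 2) ^ (1 / 2 : ℝ) * (∑' n : ℕ, ‖c n‖ ^ 2) ^ (1 / 2 : ℝ)) ↔
    (∃ C₂ : ℝ, 0 ≤ C₂ ∧ ∀ a : ℕ → ℍ[ℝ], Summable (fun n => ‖a n‖ ^ 2) →
      ENNReal.ofReal (1 / 4) *
        ∫⁻ I : Metric.sphere (0 : EuclideanSpace ℝ (Fin 3)) 1,
          (∫⁻ p in {p : ℝ × ℝ | p.1 ^ 2 + p.2 ^ 2 < 1},
            (‖∑' n : ℕ, ((p.1 : ℍ[ℝ]) + p.2 • iQ (I : EuclideanSpace ℝ (Fin 3))) ^ n * a n‖₊ : ℝ≥0∞) ^ 2 *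
            (‖cullenDeriv b ((p.1 : ℍ[ℝ]) + p.2 • iQ (I : EuclideanSpace ℝ (Fin 3)))‖₊ : ℝ≥0∞) ^ 2 *
            ENNReal.ofReal (1 - p.1 ^ 2 - p.2 ^ 2) ∂(volume : Measure (ℝ × ℝ)))
          ∂((volume : Measure (EuclideanSpace ℝ (Fin 3))).toSphere)
        ≤ ENNReal.ofReal (C₂ * ∑' n : ℕ, ‖a n‖ ^ 2)) := by
  have hconv := SliceHankel.convOn_quatCoord hb
  simp_rw [SliceHankel.lintegral_unitDisc_eq_sliceIntegral]
  constructor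
  · rintro ⟨C, -, h⟩
    have hH := fun i => (SliceHankel.polyHankel_of_bounded h i).hankelBound
    set σ := (volume : Measure (EuclideanSpace ℝ (Fin 3))).toSphere
    refine ⟨1 / 4 * (256 * (Real.exp (C ^ 2) * Real.pi)) * σ.real Set.univ, by positivity,
      fun a ha => ?_⟩
    have hA : 0 ≤ ∑' n, ‖a n‖ ^ 2 := tsum_nonneg fun _ => sq_nonneg _
    refine (mul_le_mul' le_rfl (lintegral_mono (μ := σ) fun I =>
      SliceHankel.sliceIntegral_le I (sq_nonneg C) hconv hH ha)).trans (le_of_eq ?_)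
    rw [lintegral_const, ← ofReal_measureReal, ← ENNReal.ofReal_mul (by positivity),
      ← ENNReal.ofReal_mul (by norm_num)]
    congr 1
    ring
  · rintro ⟨C, hC, h⟩
    have hP := fun i => (SliceHankel.polyCarleson_of_carleson hconv h i).hankel_le
      (by positivity) (hconv i)
    choose K hK hKle using hP
    refine ⟨∑ i : Fin 4, ∑ _p : Fin 4, ∑ _q : Fin 4, K i,
      Finset.sum_nonneg fun i _ => Finset.sum_nonneg fun _ _ => Finset.sum_nonneg fun _ _ => hK i,
      fun a c ha hc => ?_⟩
    rw [← Real.sqrt_eq_rpow, ← Real.sqrt_eq_rpow]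
    exact SliceHankel.bounded_of_polyHankel hK hKle ha hc
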